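/- arXiv:math/0412466 — 3 statements merged into one kernel-verified Lean document; each statement's English description precedes it below -/
import Mathlib

section
/- Let A = R/I be a graded Artinian Gorenstein quotient of R = K[w,x,y,z] of socle degree j ≥ 4 with I_1 = 0 and I_2 = span{w², wx, wy}, and let H = H(A) be its Hilbert function. Then: (1) ΔH_{≤ j/2} is an O-sequence; and (2) there exists a height three Gorenstein sequence H' (the Hilbert function of some graded Artinian Gorenstein quotient of K[x,y,z]) of socle degree j such that H_0 = H'_0 = 1, H_i = H'_i + 1 for all 1 ≤ i ≤ j−1, and H_j = H'_j = 1. -/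
open MvPolynomial

noncomputable section

/-- The Hilbert function of the graded quotient `R/I`, where
`R = K[x_1,...,x_n]`: the dimension of the image in `R/I` of the space of
degree-`i` homogeneous forms. -/
def hilb (n : ℕ) (K : Type*) [Field K] (I : Ideal (MvPolynomial (Fin n) K)) (i : ℕ) : ℕ :=
  Module.finrank K
    ((homogeneousSubmodule (Fin n) K i).map (Ideal.Quotient.mkₐ K I).toLinearMap)

/-- The socle `(0 : A_+)` of `A = R/I`: the elements killed by (the images of)
all the variables, equivalently by the irrelevant maximal ideal. -/
def socleSub (n : ℕ) (K : Type*) [Field K] (I : Ideal (MvPolynomial (Fin n) K)) :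
    Submodule K (MvPolynomial (Fin n) K ⧸ I) :=
  ⨅ k : Fin n, LinearMap.ker (LinearMap.mulLeft K (Ideal.Quotient.mk I (X k)))

/-- A homogeneous (graded) ideal: one containing each homogeneous component of
each of its elements. -/
def IdealHomog {n : ℕ} {K : Type*} [Field K] (I : Ideal (MvPolynomial (Fin n) K)) : Prop :=
  ∀ f ∈ I, ∀ d : ℕ, homogeneousComponent d f ∈ I

/-- `R/I` is a graded Artinian Gorenstein quotient of `R = K[x_1,...,x_n]`
of socle degree `j`: `I` is homogeneous, `R/I` is finite dimensional over `K`
with 1-dimensional socle, and `j` is the top nonzero degree. -/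
def IsAG (n : ℕ) (K : Type*) [Field K] (I : Ideal (MvPolynomial (Fin n) K)) (j : ℕ) : Prop :=
  IdealHomog I ∧ FiniteDimensional K (MvPolynomial (Fin n) K ⧸ I) ∧
    Module.finrank K (socleSub n K I) = 1 ∧
    hilb n K I j ≠ 0 ∧ ∀ i, j < i → hilb n K I i = 0

/-- Macaulay's bound `c^{(d)}`: writing `c = C(k_d,d) + ... + C(k_1,1)` with
`k_d > k_d-1 > ... > k_1 ≥ 0` (the `d`-th Macaulay expansion, computed greedily),
`c^{(d)} = C(k_d+1,d+1) + ... + C(k_1+1,2)`; by convention `0^{(d)} = 0`. -/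
def macB : ℕ → ℕ → ℕ
  | _, 0 => 0
  | c, (d+1) =>
    if c = 0 then 0 else
      let k := Nat.findGreatest (fun k => Nat.choose k (d+1) ≤ c) (c + d + 1)
      Nat.choose (k+1) (d+2) + macB (c - Nat.choose k (d+1)) d

/-- `(t_0, ..., t_m)` is an O-sequence: `t_0 = 1` and `t_{i+1} ≤ t_i^{(i)}`
for `1 ≤ i ≤ m-1`. -/
def IsOSeq (t : ℕ → ℕ) (m : ℕ) : Prop :=
  t 0 = 1 ∧ ∀ i, 1 ≤ i → i + 1 ≤ m → t (i + 1) ≤ macB (t i) i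

/-- `ΔH_{≤ m}` is an O-sequence: the first differences `ΔH_i = h_i - h_{i-1}`
(with `ΔH_0 = 1`) are nonnegative for `i ≤ m`, and `(ΔH_0, ..., ΔH_m)` is an
O-sequence. -/
def DeltaOSeq (h : ℕ → ℕ) (m : ℕ) : Prop :=
  (∀ i, 1 ≤ i → i ≤ m → h (i - 1) ≤ h i) ∧
    IsOSeq (fun i => if i = 0 then 1 else h i - h (i - 1)) m


section basics
variable {n : ℕ} {K : Type*} [Field K]

instance homSub_finite (d : ℕ) :
    Module.Finite K (homogeneousSubmodule (Fin n) K d) :=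
  Module.Finite.iff_fg.mpr (homogeneousSubmodule_fg (Fin n) K d)

lemma comp_mul_of_le {d e : ℕ} {l g : MvPolynomial (Fin n) K} (hl : l.IsHomogeneous d)
    (h : d ≤ e) :
    homogeneousComponent e (l * g) = l * homogeneousComponent (e - d) g := by
  let := MvPolynomial.gradedAlgebra (σ := Fin n) (R := K)
  have := DirectSum.coe_decompose_mul_of_left_mem_of_le (homogeneousSubmodule (Fin n) K)
    (a := l) (b := g) hl h
  erw [decomposition.decompose'_apply, decomposition.decompose'_apply] at this
  exact this

lemma comp_mul_of_lt {d e : ℕ} {l g : MvPolynomial (Fin n) K} (hl : l.IsHomogeneous d)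
    (h : e < d) :
    homogeneousComponent e (l * g) = 0 := by
  let := MvPolynomial.gradedAlgebra (σ := Fin n) (R := K)
  have := DirectSum.coe_decompose_mul_of_left_mem_of_not_le (homogeneousSubmodule (Fin n) K)
    (a := l) (b := g) hl (not_le.mpr h)
  erw [decomposition.decompose'_apply] at this
  exact this

lemma mem_of_comp_mem {I : Ideal (MvPolynomial (Fin n) K)} {f : MvPolynomial (Fin n) K}
    (h : ∀ d, homogeneousComponent d f ∈ I) : f ∈ I := by
  rw [← sum_homogeneousComponent f]
  exact I.sum_mem fun d _ => h d

/-- induction for homogeneous polynomials: enough to treat monomials -/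
lemma hom_induction {d : ℕ} (W : Submodule K (MvPolynomial (Fin n) K))
    (h : ∀ s : Fin n →₀ ℕ, s.degree = d → monomial s (1 : K) ∈ W)
    {f : MvPolynomial (Fin n) K} (hf : f.IsHomogeneous d) : f ∈ W := by
  rw [← f.support_sum_monomial_coeff]
  refine W.sum_mem fun s hs => ?_
  have hd : s.degree = d := by
    by_contra hne
    exact (mem_support_iff.mp hs) (hf.coeff_eq_zero hne)
  have := W.smul_mem (coeff s f) (h s hd)
  rwa [smul_monomial, smul_eq_mul, mul_one] at this

/-- a homogeneous form of positive degree: enough to treat products with a variable -/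
lemma hom_induction_succ {d : ℕ} (W : Submodule K (MvPolynomial (Fin n) K))
    (h : ∀ k, ∀ g : MvPolynomial (Fin n) K, g.IsHomogeneous d → X k * g ∈ W)
    {f : MvPolynomial (Fin n) K} (hf : f.IsHomogeneous (d + 1)) : f ∈ W := by
  refine hom_induction W (fun s hs => ?_) hf
  have hne : s ≠ 0 := by rintro rfl; simp at hs
  obtain ⟨k, hk⟩ := Finsupp.ne_iff.mp hne
  have hk' : Finsupp.single k 1 ≤ s := by
    rw [Finsupp.single_le_iff]; exact Nat.one_le_iff_ne_zero.mpr hk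
  have e : Finsupp.single k 1 + (s - Finsupp.single k 1) = s := add_tsub_cancel_of_le hk'
  have : monomial s (1 : K) = X k * monomial (s - Finsupp.single k 1) 1 := by
    rw [X, monomial_mul, e, one_mul]
  rw [this]
  apply h
  apply isHomogeneous_monomial
  have h2 := congrArg Finsupp.degree e
  rw [map_add, hs, Finsupp.degree_single] at h2
  omega

lemma finrank_homSub (n d : ℕ) (K : Type*) [Field K] :
    Module.finrank K (homogeneousSubmodule (Fin (n+1)) K d) = (n + d).choose d := by
  have e : homogeneousSubmodule (Fin (n+1)) K d =
      restrictSupport K {s : Fin (n+1) →₀ ℕ | s.degree = d} :=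
    homogeneousSubmodule_eq_finsupp_supported _ _ d
  rw [e, Module.finrank_eq_nat_card_basis (basisRestrictSupport K _)]
  have : {s : Fin (n+1) →₀ ℕ | s.degree = d} =
      ((Finset.univ : Finset (Fin (n+1))).finsuppAntidiag d : Set _) := by
    ext s
    simp [Finset.mem_finsuppAntidiag, Finsupp.degree_eq_sum]
  rw [this, Nat.card_coe_set_eq, Set.ncard_coe_finset, Finset.card_finsuppAntidiag_nat_eq_choose]
  simp

end basics

section linalg
variable {K V V' V'' : Type*} [Field K] [AddCommGroup V] [Module K V]
  [AddCommGroup V'] [Module K V'] [AddCommGroup V''] [Module K V'']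

lemma finrank_map_eq_of_ker (W : Submodule K V) [FiniteDimensional K W]
    (f : V →ₗ[K] V') (g : V →ₗ[K] V'') (h : ∀ v ∈ W, f v = 0 ↔ g v = 0) :
    Module.finrank K (W.map f) = Module.finrank K (W.map g) := by
  have h1 := (f.domRestrict W).finrank_range_add_finrank_ker
  have h2 := (g.domRestrict W).finrank_range_add_finrank_ker
  have h3 : LinearMap.ker (f.domRestrict W) = LinearMap.ker (g.domRestrict W) := by
    ext ⟨v, hv⟩
    simpa using h v hv
  rw [LinearMap.range_domRestrict] at h1 h2
  rw [h3] at h1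
  omega

lemma finrank_step [FiniteDimensional K V] (P Q P' Q' : Submodule K V) (μ : V →ₗ[K] V)
    (hQP : Q ≤ P) (hP' : P' ≤ Q' ⊔ P.map μ) (hQ : Q.map μ ≤ Q') :
    Module.finrank K P' + Module.finrank K Q ≤ Module.finrank K Q' + Module.finrank K P := by
  obtain ⟨C, hC⟩ := Submodule.exists_isCompl (Q.comap P.subtype)
  have hsum := Submodule.finrank_add_eq_of_isCompl hC
  have e1 : Module.finrank K (Q.comap P.subtype) = Module.finrank K Q :=
    (Submodule.comapSubtypeEquivOfLe hQP).finrank_eq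
  have hle : P' ≤ Q' ⊔ (C.map P.subtype).map μ := by
    refine hP'.trans (sup_le le_sup_left ?_)
    have : P ≤ Q ⊔ C.map P.subtype := by
      have := congrArg (Submodule.map P.subtype) hC.sup_eq_top
      rw [Submodule.map_sup, Submodule.map_subtype_top] at this
      refine this.ge.trans ?_
      exact sup_le_sup_right (Submodule.map_comap_le _ _) _
    refine (Submodule.map_mono this).trans ?_
    rw [Submodule.map_sup]
    exact sup_le_sup_right hQ _
  have h1 := Submodule.finrank_mono hle
  have h2 := Submodule.finrank_add_le_finrank_add_finrank Q' ((C.map P.subtype).map μ)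
  have h3 := Submodule.finrank_map_le μ (C.map P.subtype)
  have h4 := Submodule.finrank_map_le P.subtype C
  omega

end linalg

section dual
variable {n : ℕ} {K : Type*} [Field K]

/-- Macaulay duality with respect to a functional -/
def DualPk (I : Ideal (MvPolynomial (Fin n) K)) (j : ℕ) (φ : MvPolynomial (Fin n) K →ₗ[K] K) :
    Prop :=
  ∀ a b, a + b = j → ∀ f : MvPolynomial (Fin n) K, f.IsHomogeneous a →
    (f ∈ I ↔ ∀ g : MvPolynomial (Fin n) K, g.IsHomogeneous b → φ (f * g) = 0)

/-- rank of multiplication by `u` on degree `a` -/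
def rk (I : Ideal (MvPolynomial (Fin n) K)) (u : MvPolynomial (Fin n) K) (a : ℕ) : ℕ :=
  Module.finrank K ((homogeneousSubmodule (Fin n) K a).map
    ((Ideal.Quotient.mkₐ K I).toLinearMap ∘ₗ LinearMap.mulLeft K u))

lemma rk_one (I : Ideal (MvPolynomial (Fin n) K)) (a : ℕ) : rk I 1 a = hilb n K I a := by
  unfold rk hilb
  have : (Ideal.Quotient.mkₐ K I).toLinearMap ∘ₗ LinearMap.mulLeft K 1 =
      (Ideal.Quotient.mkₐ K I).toLinearMap := by
    ext; simp
  rw [this]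

lemma finrank_range_flip {V W : Type*} [AddCommGroup V] [Module K V] [AddCommGroup W] [Module K W]
    [FiniteDimensional K V] [FiniteDimensional K W] (B : V →ₗ[K] W →ₗ[K] K) :
    Module.finrank K (LinearMap.range B.flip) = Module.finrank K (LinearMap.range B) := by
  have : B.flip = (B.dualMap : Module.Dual K (Module.Dual K W) →ₗ[K] _) ∘ₗ
      (Module.Dual.eval K W) := by
    ext; simp
  rw [this, LinearMap.range_comp_of_range_eq_top]
  · exact LinearMap.finrank_range_dualMap_eq_finrank_range B
  · exact LinearMap.range_eq_top.mpr (Module.bijective_dual_eval K W).2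

variable {I : Ideal (MvPolynomial (Fin n) K)} {j : ℕ} {φ : MvPolynomial (Fin n) K →ₗ[K] K}

/-- the bilinear form `(f,g) ↦ φ (u f g)` -/
def bil (φ : MvPolynomial (Fin n) K →ₗ[K] K) (u : MvPolynomial (Fin n) K) :
    MvPolynomial (Fin n) K →ₗ[K] MvPolynomial (Fin n) K →ₗ[K] K :=
  ((LinearMap.mul K (MvPolynomial (Fin n) K)).compr₂ φ) ∘ₗ LinearMap.mulLeft K u

lemma bil_apply (u f g : MvPolynomial (Fin n) K) : bil φ u f g = φ (u * f * g) := rfl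

lemma rk_eq (h : DualPk I j φ) {u : MvPolynomial (Fin n) K} {d a b : ℕ}
    (hu : u.IsHomogeneous d) (hab : d + a + b = j) :
    rk I u a = Module.finrank K (LinearMap.range ((bil φ u).domRestrict₁₂
      (homogeneousSubmodule (Fin n) K a) (homogeneousSubmodule (Fin n) K b))) := by
  unfold rk
  have e : LinearMap.range ((bil φ u).domRestrict₁₂
      (homogeneousSubmodule (Fin n) K a) (homogeneousSubmodule (Fin n) K b)) =
      (homogeneousSubmodule (Fin n) K a).map
        ((LinearMap.lcomp K K (homogeneousSubmodule (Fin n) K b).subtype) ∘ₗ (bil φ u)) := by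
    ext x
    simp only [LinearMap.mem_range, Submodule.mem_map]
    constructor
    · rintro ⟨⟨y, hy⟩, rfl⟩
      exact ⟨y, hy, rfl⟩
    · rintro ⟨y, hy, rfl⟩
      exact ⟨⟨y, hy⟩, rfl⟩
  rw [e]
  apply finrank_map_eq_of_ker
  intro f hf
  have h1 := h (d + a) b hab (u * f) (hu.mul hf)
  have h2 : ((Ideal.Quotient.mkₐ K I).toLinearMap ∘ₗ LinearMap.mulLeft K u) f = 0 ↔ u * f ∈ I := by
    rw [← Ideal.Quotient.eq_zero_iff_mem]; rfl
  rw [h2, h1]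
  constructor
  · intro h3
    ext ⟨g, hg⟩
    exact h3 g hg
  · intro h3 g hg
    exact LinearMap.congr_fun h3 ⟨g, hg⟩

lemma rk_symm (h : DualPk I j φ) {u : MvPolynomial (Fin n) K} {d a b : ℕ}
    (hu : u.IsHomogeneous d) (hab : d + a + b = j) : rk I u a = rk I u b := by
  rw [rk_eq h hu hab, rk_eq h hu (show d + b + a = j by omega), ← finrank_range_flip]
  have : ((bil φ u).domRestrict₁₂ (homogeneousSubmodule (Fin n) K a)
      (homogeneousSubmodule (Fin n) K b)).flip = (bil φ u).domRestrict₁₂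
      (homogeneousSubmodule (Fin n) K b) (homogeneousSubmodule (Fin n) K a) := by
    refine LinearMap.ext fun f => LinearMap.ext fun g => ?_
    change φ (u * g.1 * f.1) = φ (u * f.1 * g.1)
    congr 1; ring
  rw [this]

lemma hilb_symm (h : DualPk I j φ) {a b : ℕ} (hab : a + b = j) :
    hilb n K I a = hilb n K I b := by
  rw [← rk_one, ← rk_one]
  exact rk_symm h (isHomogeneous_one _ _) (by omega)

lemma hilb_zero_le : hilb n K I 0 ≤ 1 := by
  unfold hilb
  refine (Submodule.finrank_map_le _ _).trans ?_
  rw [homogeneousSubmodule_zero, Submodule.one_eq_span]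
  exact (finrank_span_le_card _).trans (by simp)

lemma hilb_ends (h : DualPk I j φ) (hj : hilb n K I j ≠ 0) :
    hilb n K I 0 = 1 ∧ hilb n K I j = 1 := by
  have h1 := hilb_symm h (show 0 + j = j by omega)
  have h2 := hilb_zero_le (I := I)
  omega

lemma mem_of_hilb_zero [FiniteDimensional K (MvPolynomial (Fin n) K ⧸ I)] {i : ℕ}
    (h : hilb n K I i = 0) {f : MvPolynomial (Fin n) K} (hf : f.IsHomogeneous i) : f ∈ I := by
  unfold hilb at h
  rw [Submodule.finrank_eq_zero] at h
  have : (Ideal.Quotient.mkₐ K I).toLinearMap f ∈ (⊥ : Submodule K (MvPolynomial (Fin n) K ⧸ I)) := by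
    rw [← h]; exact Submodule.mem_map_of_mem hf
  rw [← Ideal.Quotient.eq_zero_iff_mem]
  exact this

lemma exists_of_hilb_ne {i : ℕ}
    (h : hilb n K I i ≠ 0) : ∃ f : MvPolynomial (Fin n) K, f.IsHomogeneous i ∧ f ∉ I := by
  by_contra! hc
  apply h
  unfold hilb
  have : (homogeneousSubmodule (Fin n) K i).map (Ideal.Quotient.mkₐ K I).toLinearMap = ⊥ := by
    rw [eq_bot_iff]
    rintro _ ⟨f, hf, rfl⟩
    exact Ideal.Quotient.eq_zero_iff_mem.mpr (hc f hf)
  rw [this, finrank_bot]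

lemma mem_socleSub {f : MvPolynomial (Fin n) K} :
    Ideal.Quotient.mk I f ∈ socleSub n K I ↔ ∀ k, X k * f ∈ I := by
  unfold socleSub
  simp only [Submodule.mem_iInf, LinearMap.mem_ker, LinearMap.mulLeft_apply, ← map_mul,
    Ideal.Quotient.eq_zero_iff_mem]

lemma exists_dualPk (h : IsAG n K I j) : ∃ φ, DualPk I j φ := by
  obtain ⟨hhom, hfd, hsoc, hj, htop⟩ := h
  obtain ⟨⟨v, hv⟩, hv0, hspan⟩ := finrank_eq_one_iff'.mp hsoc
  have hv0' : v ≠ 0 := fun h0 => hv0 (Subtype.ext h0)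
  obtain ⟨ψ, hψ⟩ := Module.Projective.exists_dual_ne_zero K hv0'
  have hsp : ∀ w ∈ socleSub n K I, ∃ c : K, c • v = w := fun w hw => by
    obtain ⟨c, hc⟩ := hspan ⟨w, hw⟩
    exact ⟨c, congrArg Subtype.val hc⟩
  obtain ⟨u, hu, huI⟩ := exists_of_hilb_ne hj
  have hR : ∀ f : MvPolynomial (Fin n) K, f.IsHomogeneous j → Ideal.Quotient.mk I f ∈ socleSub n K I := by
    intro f hf
    rw [mem_socleSub]
    intro k
    exact mem_of_hilb_zero (htop (1 + j) (by omega)) ((isHomogeneous_X K k).mul hf)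
  refine ⟨ψ ∘ₗ (Ideal.Quotient.mkₐ K I).toLinearMap, ?_⟩
  intro a b hab f hf
  constructor
  · intro hfI g _
    have : Ideal.Quotient.mk I (f * g) = 0 := Ideal.Quotient.eq_zero_iff_mem.mpr (I.mul_mem_right g hfI)
    change ψ (Ideal.Quotient.mk I (f * g)) = 0
    rw [this, map_zero]
  · induction b generalizing a f with
    | zero =>
      intro h0
      have haj : a = j := by omega
      subst haj
      have h1 : ψ (Ideal.Quotient.mk I (f * 1)) = 0 := h0 1 (isHomogeneous_one _ _)
      rw [mul_one] at h1
      obtain ⟨c, hc⟩ := hsp _ (hR f hf)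
      rw [← hc, map_smul, smul_eq_mul, mul_eq_zero, or_iff_left hψ] at h1
      rw [h1, zero_smul] at hc
      exact Ideal.Quotient.eq_zero_iff_mem.mp hc.symm
    | succ b ih =>
      intro h0
      have hX : ∀ k, X k * f ∈ I := by
        intro k
        refine ih (1 + a) (by omega) (X k * f) ((isHomogeneous_X K k).mul hf) ?_
        intro g hg
        have := h0 (X k * g) (by simpa [add_comm] using (isHomogeneous_X K k).mul hg)
        rw [← this]; congr 1; ring
      by_contra hfI
      obtain ⟨c, hc⟩ := hsp _ (mem_socleSub.mpr hX)
      obtain ⟨c', hc'⟩ := hsp _ (hR u hu)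
      have hc0 : c ≠ 0 := by
        rintro rfl
        rw [zero_smul] at hc
        exact hfI (Ideal.Quotient.eq_zero_iff_mem.mp hc.symm)
      have hmem : u - (c' / c) • f ∈ I := by
        rw [← Ideal.Quotient.eq_zero_iff_mem, map_sub, ← hc']
        have : Ideal.Quotient.mk I ((c' / c) • f) = (c' / c) • Ideal.Quotient.mk I f :=
          map_smul (Ideal.Quotient.mkₐ K I) _ _
        rw [this, ← hc, smul_smul, div_mul_cancel₀ _ hc0, sub_self]
      have h2 := hhom _ hmem j
      rw [map_sub, map_smul, homogeneousComponent_of_mem hu, homogeneousComponent_of_mem hf,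
        if_pos rfl, if_neg (by omega), smul_zero, sub_zero] at h2
      exact huI h2

end dual

section four
variable {K : Type*} [Field K] {I : Ideal (MvPolynomial (Fin 4) K)}

/-- setting `w = 0` -/
def setW (K : Type*) [Field K] : MvPolynomial (Fin 4) K →ₐ[K] MvPolynomial (Fin 3) K :=
  aeval (Fin.cons 0 X)

lemma setW_zero : setW K (X 0) = 0 := by simp [setW]

lemma setW_succ (k : Fin 3) : setW K (X k.succ) = X k := by simp [setW]

lemma setW_rename (p : MvPolynomial (Fin 3) K) : setW K (rename Fin.succ p) = p := by
  have : (setW K).comp (rename Fin.succ) = AlgHom.id K _ := by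
    ext k; simp [setW_succ]
  exact DFunLike.congr_fun this p

lemma setW_hom {q : MvPolynomial (Fin 4) K} {d : ℕ} (hq : q.IsHomogeneous d) :
    (setW K q).IsHomogeneous d := by
  have := hq.aeval (S := K) (Fin.cons 0 X : Fin 4 → MvPolynomial (Fin 3) K) (n := 1) (by
    intro k
    refine Fin.cases ?_ (fun k => ?_) k
    · exact isHomogeneous_zero _ _ _
    · exact isHomogeneous_X _ _)
  rwa [one_mul] at this

lemma decomp {q : MvPolynomial (Fin 4) K} {d : ℕ} (hq : q.IsHomogeneous (d + 1)) :
    ∃ g : MvPolynomial (Fin 4) K, g.IsHomogeneous d ∧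
      q = rename Fin.succ (setW K q) + X 0 * g := by
  have h1 : (Ideal.Quotient.mkₐ K (Ideal.span {(X 0 : MvPolynomial (Fin 4) K)})).comp
      ((rename Fin.succ).comp (setW K)) =
      Ideal.Quotient.mkₐ K (Ideal.span {(X 0 : MvPolynomial (Fin 4) K)}) := by
    apply MvPolynomial.algHom_ext
    intro k
    refine Fin.cases ?_ (fun k => ?_) k
    · simp only [AlgHom.comp_apply, setW_zero, map_zero]
      exact (Ideal.Quotient.eq_zero_iff_mem.mpr (Ideal.mem_span_singleton_self _)).symm
    · simp only [AlgHom.comp_apply, setW_succ, rename_X]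
  have h2 : q - rename Fin.succ (setW K q) ∈ Ideal.span {(X 0 : MvPolynomial (Fin 4) K)} :=
    Ideal.Quotient.eq.mp (DFunLike.congr_fun h1 q).symm
  obtain ⟨g, hg⟩ := Ideal.mem_span_singleton.mp h2
  refine ⟨homogeneousComponent d g, homogeneousComponent_isHomogeneous _ _, ?_⟩
  have h3 := congrArg (homogeneousComponent (d + 1)) hg
  rw [comp_mul_of_le (isHomogeneous_X _ _) (by omega), homogeneousComponent_eq_self
    (hq.sub (setW_hom hq).rename_isHomogeneous), Nat.add_sub_cancel] at h3
  rw [← h3]; ring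

lemma w_mul (h0 : X 0 * X 0 ∈ I) (h1 : X 0 * X 1 ∈ I) (h2 : X 0 * X 2 ∈ I)
    {q : MvPolynomial (Fin 4) K} {d : ℕ} (hq : q.IsHomogeneous d) :
    ∃ c : K, X 0 * q - c • (X 0 * X 3 ^ d) ∈ I := by
  suffices H : q ∈ (I.restrictScalars K ⊔ Submodule.span K {X 0 * X 3 ^ d}).comap
      (LinearMap.mulLeft K (X 0)) by
    obtain ⟨a, ha, b, hb, hab⟩ := Submodule.mem_sup.mp H
    obtain ⟨c, rfl⟩ := Submodule.mem_span_singleton.mp hb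
    refine ⟨c, ?_⟩
    rw [LinearMap.mulLeft_apply] at hab
    rw [← hab]; simpa using ha
  have key : ∀ k : Fin 4, k ≠ 3 → X 0 * X k ∈ I := by
    intro k hk
    fin_cases k
    · exact h0
    · exact h1
    · exact h2
    · exact absurd rfl hk
  induction d generalizing q with
  | zero =>
    refine hom_induction _ (fun s hs => ?_) hq
    have : s = 0 := (Finsupp.degree_eq_zero_iff s).mp hs
    subst this
    apply Submodule.mem_sup_right
    simp
  | succ d ih =>
    refine hom_induction_succ _ (fun k g hg => ?_) hq
    by_cases hk : k = 3
    · subst hk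
      obtain ⟨a, ha, b, hb, hab⟩ := Submodule.mem_sup.mp (ih hg)
      obtain ⟨c, rfl⟩ := Submodule.mem_span_singleton.mp hb
      rw [LinearMap.mulLeft_apply] at hab
      refine Submodule.mem_sup.mpr ⟨X 3 * a, I.mul_mem_left _ ha, c • (X 0 * X 3 ^ (d+1)),
        Submodule.smul_mem _ _ (Submodule.mem_span_singleton_self _), ?_⟩
      rw [LinearMap.mulLeft_apply, show (X 0 : MvPolynomial (Fin 4) K) * (X 3 * g)
        = X 3 * (X 0 * g) by ring, ← hab, mul_add, mul_smul_comm]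
      congr 2; ring
    · apply Submodule.mem_sup_left
      change X 0 * (X k * g) ∈ I
      rw [← mul_assoc]
      exact I.mul_mem_right _ (key k hk)

lemma decomp' (h0 : X 0 * X 0 ∈ I) (h1 : X 0 * X 1 ∈ I) (h2 : X 0 * X 2 ∈ I)
    {q : MvPolynomial (Fin 4) K} {d : ℕ} (hq : q.IsHomogeneous (d + 1)) :
    ∃ c : K, q - (rename Fin.succ (setW K q) + c • (X 0 * X 3 ^ d)) ∈ I := by
  obtain ⟨g, hg, e⟩ := decomp hq
  obtain ⟨c, hc⟩ := w_mul h0 h1 h2 hg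
  refine ⟨c, ?_⟩
  have : q - (rename Fin.succ (setW K q) + c • (X 0 * X 3 ^ d)) = X 0 * g - c • (X 0 * X 3 ^ d) := by
    nth_rewrite 1 [e]; ring
  rwa [this]

lemma wz_not_mem {j : ℕ} {φ : MvPolynomial (Fin 4) K →ₗ[K] K} (hD : DualPk I j φ)
    (h0 : X 0 * X 0 ∈ I) (h1 : X 0 * X 1 ∈ I) (h2 : X 0 * X 2 ∈ I)
    (hw : (X 0 : MvPolynomial (Fin 4) K) ∉ I) {d : ℕ} (hd : d + 1 ≤ j) :
    (X 0 * X 3 ^ d : MvPolynomial (Fin 4) K) ∉ I := by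
  intro hmem
  apply hw
  have hmem' : (X 0 * X 3 ^ (j - 1) : MvPolynomial (Fin 4) K) ∈ I := by
    have := I.mul_mem_right (X 3 ^ (j - 1 - d)) hmem
    rwa [mul_assoc, ← pow_add, show d + (j - 1 - d) = j - 1 by omega] at this
  rw [hD 1 (j - 1) (by omega) _ (isHomogeneous_X _ _)]
  intro g hg
  obtain ⟨c, hc⟩ := w_mul h0 h1 h2 hg
  have h3 : X 0 * g ∈ I := by
    have := I.add_mem hc (Submodule.smul_of_tower_mem I c hmem')
    simpa using this
  have h4 := (hD j 0 (by omega) (X 0 * g) (by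
    have := (isHomogeneous_X K (0 : Fin 4)).mul hg
    rwa [show 1 + (j - 1) = j by omega] at this)).mp h3 1 (isHomogeneous_one _ _)
  rwa [mul_one] at h4

/-- parametrization of the degree `d+1` part -/
def par (I : Ideal (MvPolynomial (Fin 4) K)) (d : ℕ) :
    (homogeneousSubmodule (Fin 3) K (d+1) × K) →ₗ[K] (MvPolynomial (Fin 4) K ⧸ I) :=
  (Ideal.Quotient.mkₐ K I).toLinearMap ∘ₗ
    LinearMap.coprod ((rename Fin.succ).toLinearMap ∘ₗ Submodule.subtype _)
      (LinearMap.toSpanSingleton K _ (X 0 * X 3 ^ d))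

lemma par_apply (d : ℕ) (p : homogeneousSubmodule (Fin 3) K (d+1)) (c : K) :
    par I d (p, c) = Ideal.Quotient.mk I (rename Fin.succ p.1 + c • (X 0 * X 3 ^ d)) := rfl

lemma par_range (h0 : X 0 * X 0 ∈ I) (h1 : X 0 * X 1 ∈ I) (h2 : X 0 * X 2 ∈ I) (d : ℕ) :
    LinearMap.range (par I d) = (homogeneousSubmodule (Fin 4) K (d+1)).map
      (Ideal.Quotient.mkₐ K I).toLinearMap := by
  apply le_antisymm
  · rintro _ ⟨⟨p, c⟩, rfl⟩
    rw [par_apply]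
    refine Submodule.mem_map_of_mem (f := (Ideal.Quotient.mkₐ K I).toLinearMap) ?_
    apply Submodule.add_mem
    · exact IsHomogeneous.rename_isHomogeneous p.2
    · apply Submodule.smul_mem
      have := (isHomogeneous_X K (0 : Fin 4)).mul (isHomogeneous_X_pow (R := K) (3 : Fin 4) d)
      rwa [add_comm] at this
  · rintro _ ⟨q, hq, rfl⟩
    obtain ⟨c, hc⟩ := decomp' h0 h1 h2 hq
    refine ⟨(⟨setW K q, setW_hom hq⟩, c), ?_⟩
    rw [par_apply]
    exact (Ideal.Quotient.eq.mpr hc).symm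

lemma hilb_add_ker (h0 : X 0 * X 0 ∈ I) (h1 : X 0 * X 1 ∈ I) (h2 : X 0 * X 2 ∈ I) (d : ℕ) :
    hilb 4 K I (d+1) + Module.finrank K (LinearMap.ker (par I d)) =
      (2 + (d+1)).choose (d+1) + 1 := by
  have := (par I d).finrank_range_add_finrank_ker
  rw [par_range h0 h1 h2, Module.finrank_prod, finrank_homSub 2, Module.finrank_self] at this
  exact this

/-- a relation in degree `d+1` -/
def HasRel (I : Ideal (MvPolynomial (Fin 4) K)) (d : ℕ) : Prop :=
  ∃ p : MvPolynomial (Fin 3) K, p ≠ 0 ∧ p.IsHomogeneous (d+1) ∧ ∃ c : K,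
    rename Fin.succ p + c • (X 0 * X 3 ^ d) ∈ I

lemma full_of_not_rel (h0 : X 0 * X 0 ∈ I) (h1 : X 0 * X 1 ∈ I) (h2 : X 0 * X 2 ∈ I) {d : ℕ}
    (hwz : (X 0 * X 3 ^ d : MvPolynomial (Fin 4) K) ∉ I)
    (h : ¬ HasRel I d) : hilb 4 K I (d+1) = (2 + (d+1)).choose (d+1) + 1 := by
  have : LinearMap.ker (par I d) = ⊥ := by
    rw [eq_bot_iff]
    rintro ⟨⟨p, hp⟩, c⟩ hpc
    rw [LinearMap.mem_ker, par_apply, Ideal.Quotient.eq_zero_iff_mem] at hpc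
    by_cases hp0 : p = 0
    · subst hp0
      by_cases hc : c = 0
      · subst hc; rfl
      · exfalso
        rw [map_zero, zero_add] at hpc
        apply hwz
        have := Submodule.smul_of_tower_mem I c⁻¹ hpc
        rwa [smul_smul, inv_mul_cancel₀ hc, one_smul] at this
    · exact absurd ⟨p, hp0, hp, c, hpc⟩ h
  have h3 := hilb_add_ker h0 h1 h2 d
  rw [this, finrank_bot] at h3
  exact h3

lemma rel_succ {d : ℕ} (h : HasRel I d) : HasRel I (d+1) := by
  obtain ⟨p, hp0, hp, c, hc⟩ := h
  refine ⟨X 2 * p, mul_ne_zero (X_ne_zero _) hp0, ?_, c, ?_⟩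
  · have := (isHomogeneous_X K (2 : Fin 3)).mul hp
    rwa [add_comm 1] at this
  · have := I.mul_mem_left (X 3) hc
    rw [map_mul, rename_X]
    convert this using 1
    rw [mul_add, mul_smul_comm]
    congr 2
    ring

lemma not_rel_one (hI2 : Submodule.restrictScalars K I ⊓ homogeneousSubmodule (Fin 4) K 2 =
      Submodule.span K {X 0 ^ 2, X 0 * X 1, X 0 * X 2}) : ¬ HasRel I 1 := by
  rintro ⟨p, hp0, hp, c, hc⟩
  apply hp0
  have hmem : rename Fin.succ p + c • (X 0 * X 3 ^ 1) ∈
      Submodule.restrictScalars K I ⊓ homogeneousSubmodule (Fin 4) K 2 := by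
    refine ⟨hc, ?_⟩
    apply Submodule.add_mem
    · exact hp.rename_isHomogeneous
    · apply Submodule.smul_mem
      exact (isHomogeneous_X K (0 : Fin 4)).mul (isHomogeneous_X_pow (R := K) (3 : Fin 4) 1)
  rw [hI2] at hmem
  have hle : Submodule.span K {X 0 ^ 2, X 0 * X 1, X 0 * X 2} ≤
      LinearMap.ker (setW K).toLinearMap := by
    rw [Submodule.span_le]
    rintro x (rfl | rfl | rfl) <;> simp [setW_zero]
  have := hle hmem
  simpa [setW_zero, setW_rename] using this

lemma choose_step (d : ℕ) : (2 + (d+1)).choose (d+1) = (2 + d).choose d + (d + 2) := by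
  rw [show 2 + (d+1) = (d + 2) + 1 by ring, Nat.choose_succ_succ, add_comm 2 d]
  congr 1
  exact Nat.choose_succ_self_right (d+1)

end four

section four
variable {K : Type*} [Field K] {I : Ideal (MvPolynomial (Fin 4) K)}

lemma eval_on_line {N : Ideal (MvPolynomial (Fin 4) K)} (v : Fin 3 → K)
    (hv : ∀ k : Fin 3, v 0 • (X k.succ : MvPolynomial (Fin 4) K) - v k • X 1 ∈ N) (d : ℕ)
    {g : MvPolynomial (Fin 3) K} (hg : g.IsHomogeneous d) :
    v 0 ^ d • rename Fin.succ g - eval v g • X 1 ^ d ∈ N := by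
  suffices H : g ∈ (N.restrictScalars K).comap
      ((v 0 ^ d • (rename Fin.succ).toLinearMap) -
        (LinearMap.toSpanSingleton K (MvPolynomial (Fin 4) K) (X 1 ^ d)) ∘ₗ
          (aeval (R := K) v).toLinearMap) by
    exact H
  induction d generalizing g with
  | zero =>
    refine hom_induction _ (fun s hs => ?_) hg
    have : s = 0 := (Finsupp.degree_eq_zero_iff s).mp hs
    subst this
    simp
  | succ d ih =>
    refine hom_induction_succ _ (fun k g hg => ?_) hg
    have h1 : v 0 ^ d • rename Fin.succ g - eval v g • X 1 ^ d ∈ N := ih hg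
    change v 0 ^ (d+1) • rename Fin.succ (X k * g) - eval v (X k * g) • X 1 ^ (d+1) ∈ N
    have h2 := N.add_mem (N.mul_mem_left (v 0 • X k.succ) h1)
      (N.mul_mem_left (eval v g • X 1 ^ d) (hv k))
    convert h2 using 1
    simp only [map_mul, rename_X, eval_X, smul_eq_C_mul, map_pow]
    ring

lemma generated_by_two [Infinite K]
    (h0 : X 0 * X 0 ∈ I) (h1 : X 0 * X 1 ∈ I) (h2 : X 0 * X 2 ∈ I) (hhom : IdealHomog I)
    {e : ℕ} (hR : HasRel I (e+1)) :
    ∃ l m : MvPolynomial (Fin 4) K, l.IsHomogeneous 1 ∧ m.IsHomogeneous 1 ∧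
      ∀ k, e ≤ k → ∀ q : MvPolynomial (Fin 4) K, q.IsHomogeneous (k + 2) →
        ∃ g h : MvPolynomial (Fin 4) K, g.IsHomogeneous (k+1) ∧ h.IsHomogeneous (k+1) ∧
          q - (l * g + m * h) ∈ I := by
  obtain ⟨p, hp0, hp, c, hc⟩ := hR
  obtain ⟨v, hv⟩ : ∃ v : Fin 3 → K, eval v (p * X 0) ≠ 0 := by
    by_contra! hcon
    exact mul_ne_zero hp0 (X_ne_zero (0 : Fin 3)) (MvPolynomial.funext (fun v => by simp [hcon v]))
  rw [map_mul, eval_X] at hv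
  have hv0 : v 0 ≠ 0 := right_ne_zero_of_mul hv
  have hvp : eval v p ≠ 0 := left_ne_zero_of_mul hv
  set l : MvPolynomial (Fin 4) K := v 0 • X 3 - v 2 • X 1 with hl
  set m : MvPolynomial (Fin 4) K := v 0 • X 2 - v 1 • X 1 with hm
  have hlh : l.IsHomogeneous 1 := by
    apply IsHomogeneous.sub <;> rw [smul_eq_C_mul] <;> exact isHomogeneous_C_mul_X _ _
  have hmh : m.IsHomogeneous 1 := by
    apply IsHomogeneous.sub <;> rw [smul_eq_C_mul] <;> exact isHomogeneous_C_mul_X _ _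
  refine ⟨l, m, hlh, hmh, ?_⟩
  set N : Ideal (MvPolynomial (Fin 4) K) := I ⊔ Ideal.span {l, m} with hN
  have hIN : I ≤ N := le_sup_left
  have hlN : l ∈ N := Ideal.mem_sup_right (Ideal.subset_span (by simp))
  have hmN : m ∈ N := Ideal.mem_sup_right (Ideal.subset_span (by simp))
  have hvN : ∀ k : Fin 3, v 0 • (X k.succ : MvPolynomial (Fin 4) K) - v k • X 1 ∈ N := by
    intro k
    fin_cases k
    · simp
    · exact hmN
    · exact hlN
  have hsm : ∀ {a : K} {f : MvPolynomial (Fin 4) K}, a ≠ 0 → a • f ∈ N → f ∈ N := by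
    intro a f ha hf
    have := Submodule.smul_of_tower_mem N a⁻¹ hf
    rwa [smul_smul, inv_mul_cancel₀ ha, one_smul] at this
  have hwz : ∀ d, (X 0 * X 3 ^ (d+1) : MvPolynomial (Fin 4) K) ∈ N := by
    intro d
    have : (X 0 * X 3 : MvPolynomial (Fin 4) K) ∈ N := by
      apply hsm hv0
      have := N.add_mem (N.mul_mem_left (X 0) hlN)
        (Submodule.smul_of_tower_mem N (v 2) (hIN h1))
      convert this using 1
      simp only [hl, smul_eq_C_mul]; ring
    have := N.mul_mem_right (X 3 ^ d) this
    rwa [mul_assoc, ← pow_succ'] at this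
  have hx : (X 1 ^ (e+2) : MvPolynomial (Fin 4) K) ∈ N := by
    apply hsm hvp
    have a1 := eval_on_line v hvN _ hp
    have a2 : rename Fin.succ p ∈ N := by
      have := N.sub_mem (hIN hc) (Submodule.smul_of_tower_mem N c (hwz e))
      rwa [add_sub_cancel_right] at this
    have a3 := N.sub_mem (Submodule.smul_of_tower_mem N (v 0 ^ (e+1+1)) a2) a1
    rwa [sub_sub_cancel] at a3
  intro k hk q hq
  have hqN : q ∈ N := by
    obtain ⟨c', hc'⟩ := decomp' (d := k+1) h0 h1 h2 hq
    have b1 := eval_on_line v hvN _ (setW_hom hq)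
    have b2 : (X 1 ^ (k+2) : MvPolynomial (Fin 4) K) ∈ N := by
      have := N.mul_mem_right (X 1 ^ (k - e)) hx
      rwa [← pow_add, show e + 2 + (k - e) = k + 2 by omega] at this
    have b3 : rename Fin.succ (setW K q) ∈ N := by
      apply hsm (pow_ne_zero (k+2) hv0)
      have := N.add_mem b1 (Submodule.smul_of_tower_mem N (eval v (setW K q)) b2)
      rwa [sub_add_cancel] at this
    have b4 := N.add_mem (hIN hc') (N.add_mem b3 (Submodule.smul_of_tower_mem N c' (hwz k)))
    rwa [sub_add_cancel] at b4
  obtain ⟨a, ha, b, hb, hab⟩ := Submodule.mem_sup.mp hqN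
  obtain ⟨g, h, hgh⟩ := Ideal.mem_span_pair.mp hb
  refine ⟨homogeneousComponent (k+1) g, homogeneousComponent (k+1) h,
    homogeneousComponent_isHomogeneous _ _, homogeneousComponent_isHomogeneous _ _, ?_⟩
  have h5 := congrArg (homogeneousComponent (k+2)) hab
  rw [homogeneousComponent_eq_self hq, ← hgh, map_add, map_add, mul_comm g, mul_comm h,
    comp_mul_of_le hlh (by omega), comp_mul_of_le hmh (by omega),
    show k + 2 - 1 = k + 1 by omega] at h5
  rw [← h5, add_sub_cancel_right]
  exact hhom a ha _

lemma step_of_rel [Infinite K] [FiniteDimensional K (MvPolynomial (Fin 4) K ⧸ I)]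
    (h0 : X 0 * X 0 ∈ I) (h1 : X 0 * X 1 ∈ I) (h2 : X 0 * X 2 ∈ I) (hhom : IdealHomog I)
    {e : ℕ} (hR : HasRel I (e+1)) :
    ∃ l : MvPolynomial (Fin 4) K, l.IsHomogeneous 1 ∧
      ∀ k, e ≤ k → hilb 4 K I (k+2) + rk I l k ≤ rk I l (k+1) + hilb 4 K I (k+1) := by
  obtain ⟨l, m, hl, hm, H⟩ := generated_by_two h0 h1 h2 hhom hR
  refine ⟨l, hl, fun k hk => ?_⟩
  refine finrank_step _ _ _ _ (LinearMap.mulLeft K (Ideal.Quotient.mk I m)) ?_ ?_ ?_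
  · rintro _ ⟨f, hf, rfl⟩
    refine ⟨l * f, ?_, rfl⟩
    have := hl.mul hf
    rwa [add_comm 1] at this
  · rintro _ ⟨q, hq, rfl⟩
    obtain ⟨g, h, hg, hh, hgh⟩ := H k hk q hq
    have : (Ideal.Quotient.mkₐ K I).toLinearMap q =
        Ideal.Quotient.mk I (l * g) + Ideal.Quotient.mk I m * Ideal.Quotient.mk I h := by
      rw [← map_mul, ← map_add]
      exact Ideal.Quotient.eq.mpr hgh
    rw [this]
    refine Submodule.add_mem_sup ⟨g, hg, rfl⟩ ⟨Ideal.Quotient.mk I h, ⟨h, hh, rfl⟩, rfl⟩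
  · rintro _ ⟨_, ⟨f, hf, rfl⟩, rfl⟩
    refine ⟨m * f, ?_, ?_⟩
    · have := hm.mul hf
      rwa [add_comm 1] at this
    · change Ideal.Quotient.mk I (l * (m * f)) = Ideal.Quotient.mk I m * Ideal.Quotient.mk I (l * f)
      rw [← map_mul]; congr 1; ring

/-- numerical consequence of a relation in degree `e+2` -/
lemma num_of_rel [Infinite K] [FiniteDimensional K (MvPolynomial (Fin 4) K ⧸ I)]
    (h0 : X 0 * X 0 ∈ I) (h1 : X 0 * X 1 ∈ I) (h2 : X 0 * X 2 ∈ I) (hhom : IdealHomog I)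
    {j : ℕ} {φ : MvPolynomial (Fin 4) K →ₗ[K] K} (hD : DualPk I j φ)
    {e : ℕ} (hR : HasRel I (e+1)) (he : 2 * (e + 2) ≤ j) :
    hilb 4 K I (e+1) ≤ hilb 4 K I (e+2) ∧
      hilb 4 K I (e+3) + hilb 4 K I (e+1) ≤ 2 * hilb 4 K I (e+2) := by
  obtain ⟨l, hl, H⟩ := step_of_rel h0 h1 h2 hhom hR
  obtain ⟨a, rfl⟩ : ∃ a, j = 2 * (e + 2) + a := ⟨j - 2 * (e+2), by omega⟩
  set c : ℕ → ℤ := fun k => (hilb 4 K I (k+1) : ℤ) - rk I l k with hc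
  have hstep : ∀ k, e ≤ k → c (k+1) ≤ c k := by
    intro k hk
    have := H k hk
    simp only [hc, show k + 1 + 1 = k + 2 by ring]
    omega
  have hanti : ∀ x y, e ≤ x → x ≤ y → c y ≤ c x := by
    intro x y hx hxy
    induction y, hxy using Nat.le_induction with
    | base => exact le_rfl
    | succ y hy ih => exact (hstep y (by omega)).trans ih
  have s1 := hilb_symm hD (show (e + 1) + (e + 3 + a) = 2 * (e+2) + a by ring)
  have s2 := hilb_symm hD (show (e + 2) + (e + 2 + a) = 2 * (e+2) + a by ring)
  have r1 := rk_symm hD hl (show 1 + (e + 1) + (e + 2 + a) = 2 * (e+2) + a by ring)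
  have r2 := rk_symm hD hl (show 1 + (e + 2) + (e + 1 + a) = 2 * (e+2) + a by ring)
  have g1 := hanti (e+1) (e+2+a) (by omega) (by omega)
  have g2 := hanti (e+1) (e+2) (by omega) (by omega)
  have g3 := hanti (e+1+a) (e+2+a) (by omega) (by omega)
  simp only [hc, show e + 1 + 1 = e + 2 by ring, show e + 2 + 1 = e + 3 by ring,
    show e + 1 + a + 1 = e + 2 + a by ring, show e + 2 + a + 1 = e + 3 + a by ring] at g1 g2 g3
  omega

/-- the numerical information about `H` -/
lemma num_main [Infinite K] {j : ℕ} (hj : 4 ≤ j) (hI : IsAG 4 K I j)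
    (hI1 : ∀ f ∈ I, f.IsHomogeneous 1 → f = 0)
    (hI2 : Submodule.restrictScalars K I ⊓ homogeneousSubmodule (Fin 4) K 2 =
      Submodule.span K {X 0 ^ 2, X 0 * X 1, X 0 * X 2}) :
    hilb 4 K I 1 = 4 ∧ hilb 4 K I 2 = 7 ∧
    ∀ e, 2 * (e + 2) ≤ j → hilb 4 K I (e+1) ≤ hilb 4 K I (e+2) ∧
      ((hilb 4 K I (e+2) = hilb 4 K I (e+1) + (e + 3) ∧
        hilb 4 K I (e+3) ≤ hilb 4 K I (e+2) + (e + 4)) ∨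
      hilb 4 K I (e+3) + hilb 4 K I (e+1) ≤ 2 * hilb 4 K I (e+2)) := by
  obtain ⟨φ, hD⟩ := exists_dualPk hI
  obtain ⟨hhom, hfd, -, -, -⟩ := hI
  have hgen : ∀ f ∈ ({X 0 ^ 2, X 0 * X 1, X 0 * X 2} : Set (MvPolynomial (Fin 4) K)), f ∈ I := by
    intro f hf
    have := Submodule.subset_span (R := K) hf
    rw [← hI2] at this
    exact this.1
  have h0 : X 0 * X 0 ∈ I := by rw [← pow_two]; exact hgen _ (by simp)
  have h1 : X 0 * X 1 ∈ I := hgen _ (by simp)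
  have h2 : X 0 * X 2 ∈ I := hgen _ (by simp)
  have hw : (X 0 : MvPolynomial (Fin 4) K) ∉ I := fun h =>
    X_ne_zero (R := K) (0 : Fin 4) (hI1 _ h (isHomogeneous_X _ _))
  have hfull : ∀ d, d + 1 ≤ j → ¬ HasRel I d → hilb 4 K I (d+1) = (2 + (d+1)).choose (d+1) + 1 :=
    fun d hd h => full_of_not_rel h0 h1 h2 (wz_not_mem hD h0 h1 h2 hw hd) h
  have hn1 := not_rel_one hI2
  have hn0 : ¬ HasRel I 0 := fun h => hn1 (rel_succ h)
  refine ⟨by simpa using hfull 0 (by omega) hn0, by simpa [Nat.choose] using hfull 1 (by omega) hn1, ?_⟩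
  intro e he
  by_cases hR : HasRel I (e+1)
  · have := num_of_rel h0 h1 h2 hhom hD hR he
    exact ⟨this.1, Or.inr this.2⟩
  · have hR' : ¬ HasRel I e := fun h => hR (rel_succ h)
    have f1 := hfull _ (by omega) hR
    have f2 := hfull _ (by omega) hR'
    have f3 := hilb_add_ker h0 h1 h2 (e+2)
    have c1 := choose_step (e+1)
    have c2 := choose_step (e+2)
    simp only [show e + 1 + 1 = e + 2 by ring, show e + 2 + 1 = e + 3 by ring] at *
    omega

end four


section inv
variable {n : ℕ} {K : Type*} [Field K]

/-- the ideal apolar to a functional -/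
def invIdeal (φ : MvPolynomial (Fin n) K →ₗ[K] K) : Ideal (MvPolynomial (Fin n) K) where
  carrier := {f | ∀ g, φ (f * g) = 0}
  add_mem' := by
    intro a b ha hb g
    rw [add_mul, map_add, ha g, hb g, add_zero]
  zero_mem' := by intro g; simp
  smul_mem' := by
    intro c f hf g
    rw [smul_eq_mul, mul_comm c, mul_assoc]
    exact hf _

lemma mem_invIdeal {φ : MvPolynomial (Fin n) K →ₗ[K] K} {f : MvPolynomial (Fin n) K} :
    f ∈ invIdeal φ ↔ ∀ g, φ (f * g) = 0 := Iff.rfl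

variable {φ : MvPolynomial (Fin n) K →ₗ[K] K} {j : ℕ}

lemma inv_mem_of_gt (hφ : ∀ f, φ (homogeneousComponent j f) = φ f) {a : ℕ} (ha : j < a)
    {f : MvPolynomial (Fin n) K} (hf : f.IsHomogeneous a) : f ∈ invIdeal φ := by
  intro g
  rw [← hφ, comp_mul_of_lt hf ha, map_zero]

lemma inv_dualPk (hφ : ∀ f, φ (homogeneousComponent j f) = φ f) : DualPk (invIdeal φ) j φ := by
  intro a b hab f hf
  refine ⟨fun h g _ => h g, fun h g => ?_⟩
  rw [← hφ, comp_mul_of_le hf (by omega)]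
  apply h
  rw [show j - a = b by omega]
  exact homogeneousComponent_isHomogeneous _ _

lemma inv_homog (hφ : ∀ f, φ (homogeneousComponent j f) = φ f) : IdealHomog (invIdeal φ) := by
  intro f hf d
  rcases lt_or_ge j d with h | h
  · exact inv_mem_of_gt hφ h (homogeneousComponent_isHomogeneous _ _)
  · rw [inv_dualPk hφ d (j - d) (by omega) _ (homogeneousComponent_isHomogeneous _ _)]
    intro g hg
    have := comp_mul_of_le (g := f) hg (show j - d ≤ j by omega)
    rw [show j - (j - d) = d by omega] at this
    rw [mul_comm, ← this, hφ, mul_comm]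
    exact hf g

lemma inv_finite (hφ : ∀ f, φ (homogeneousComponent j f) = φ f) :
    FiniteDimensional K (MvPolynomial (Fin n) K ⧸ invIdeal φ) := by
  have : (⊤ : Submodule K (MvPolynomial (Fin n) K ⧸ invIdeal φ)) =
      ⨆ i ∈ Finset.range (j+1), (homogeneousSubmodule (Fin n) K i).map
        (Ideal.Quotient.mkₐ K (invIdeal φ)).toLinearMap := by
    symm
    rw [eq_top_iff]
    rintro x -
    obtain ⟨f, rfl⟩ := Ideal.Quotient.mk_surjective x
    rw [← sum_homogeneousComponent f, map_sum]
    refine Submodule.sum_mem _ fun i _ => ?_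
    by_cases hi : i ∈ Finset.range (j+1)
    · exact Submodule.mem_iSup_of_mem i (Submodule.mem_iSup_of_mem hi
        ⟨_, homogeneousComponent_isHomogeneous _ _, rfl⟩)
    · rw [Ideal.Quotient.eq_zero_iff_mem.mpr]
      · exact Submodule.zero_mem _
      · exact inv_mem_of_gt hφ (by simpa using hi) (homogeneousComponent_isHomogeneous _ _)
  refine Module.finite_def.mpr ?_
  rw [this]
  exact Submodule.fg_biSup _ _ fun i _ => (homogeneousSubmodule_fg (Fin n) K i).map _

lemma inv_isAG (hφ : ∀ f, φ (homogeneousComponent j f) = φ f) {u : MvPolynomial (Fin n) K}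
    (hu : u.IsHomogeneous j) (hu0 : φ u ≠ 0) : IsAG n K (invIdeal φ) j := by
  have huI : u ∉ invIdeal φ := fun h => hu0 (by simpa using h 1)
  have := inv_finite hφ
  refine ⟨inv_homog hφ, inv_finite hφ, ?_, ?_, ?_⟩
  · rw [finrank_eq_one_iff']
    refine ⟨⟨Ideal.Quotient.mk _ u, mem_socleSub.mpr fun k => ?_⟩, ?_, ?_⟩
    · have := (isHomogeneous_X K k).mul hu
      exact inv_mem_of_gt hφ (by omega) this
    · intro h
      exact huI (Ideal.Quotient.eq_zero_iff_mem.mp (congrArg Subtype.val h))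
    · rintro ⟨w, hw⟩
      obtain ⟨f, rfl⟩ := Ideal.Quotient.mk_surjective w
      have hf := mem_socleSub.mp hw
      have hu' : ∀ k, X k * u ∈ invIdeal φ := fun k => by
        have := (isHomogeneous_X K k).mul hu
        exact inv_mem_of_gt hφ (by omega) this
      refine ⟨φ f / φ u, Subtype.ext ?_⟩
      change Ideal.Quotient.mk _ ((φ f / φ u) • u) = _
      rw [Ideal.Quotient.eq]
      intro g
      induction g using MvPolynomial.induction_on with
      | C a =>
        rw [mul_comm, ← smul_eq_C_mul, map_smul, map_sub, map_smul, smul_eq_mul, smul_eq_mul,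
          div_mul_cancel₀ _ hu0, sub_self, mul_zero]
      | add p q hp hq => rw [mul_add, map_add, hp, hq, add_zero]
      | mul_X p k _ =>
        have h1 := hu' k p
        have h2 := hf k p
        have : ((φ f / φ u) • u - f) * (p * X k) =
            (φ f / φ u) • (X k * u * p) - X k * f * p := by
          rw [smul_eq_C_mul, smul_eq_C_mul]; ring
        rw [this, map_sub, map_smul, h1, h2, smul_zero, sub_zero]
  · intro h
    exact huI (mem_of_hilb_zero h hu)
  · intro i hi
    by_contra hne
    obtain ⟨f, hf, hfI⟩ := exists_of_hilb_ne hne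
    exact hfI (inv_mem_of_gt hφ hi hf)
end inv


section pts
variable {K : Type*} [Field K]

/-- the polynomial `x(x-z)⋯(x-(u-1)z) · y(y-z)⋯(y-(v-1)z)` -/
def facP (K : Type*) [Field K] (u v : ℕ) : MvPolynomial (Fin 3) K :=
  (∏ k ∈ Finset.range u, (X 0 - C (k : K) * X 2)) * ∏ k ∈ Finset.range v, (X 1 - C (k : K) * X 2)

/-- falling factorial -/
def ffac (K : Type*) [Field K] (p u : ℕ) : K := ∏ k ∈ Finset.range u, ((p : K) - k)

lemma ffac_zero {p u : ℕ} (h : p < u) : ffac K p u = 0 :=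
  Finset.prod_eq_zero (Finset.mem_range.mpr h) (by simp)

lemma ffac_ne [CharZero K] {p u : ℕ} (h : u ≤ p) : ffac K p u ≠ 0 := by
  refine Finset.prod_ne_zero_iff.mpr fun k hk => ?_
  rw [sub_ne_zero]
  have := Finset.mem_range.mp hk
  exact_mod_cast (show p ≠ k by omega)

/-- evaluation at the point `(p,q,1)` -/
def evp (K : Type*) [Field K] (p : ℕ × ℕ) : MvPolynomial (Fin 3) K →ₐ[K] K :=
  aeval ![(p.1 : K), (p.2 : K), 1]

lemma evp_fac (p : ℕ × ℕ) (u v c : ℕ) :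
    evp K p (facP K u v * X 2 ^ c) = ffac K p.1 u * ffac K p.2 v := by
  simp [evp, facP, ffac, map_prod]

lemma facP_homog (u v : ℕ) : (facP K u v).IsHomogeneous (u + v) := by
  have h : ∀ (i : Fin 3) (k : ℕ), (X i - C (k : K) * X 2).IsHomogeneous 1 := fun i k =>
    (isHomogeneous_X K i).sub (by simpa using (isHomogeneous_C (Fin 3) (k : K)).mul (isHomogeneous_X K 2))
  unfold facP
  refine IsHomogeneous.mul ?_ ?_
  · simpa using IsHomogeneous.prod (Finset.range u) _ (fun _ => 1) (fun k _ => h 0 k)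
  · simpa using IsHomogeneous.prod (Finset.range v) _ (fun _ => 1) (fun k _ => h 1 k)

/-- the span of the products in degree `a` -/
def facSpan (K : Type*) [Field K] (a : ℕ) : Submodule K (MvPolynomial (Fin 3) K) :=
  Submodule.span K {f | ∃ u v c, u + v + c = a ∧ f = facP K u v * X 2 ^ c}

lemma facSpan_mul {a : ℕ} (k : Fin 3) {f : MvPolynomial (Fin 3) K} (hf : f ∈ facSpan K a) :
    X k * f ∈ facSpan K (a + 1) := by
  induction hf using Submodule.span_induction with
  | zero => simp
  | add x y _ _ hx hy => rw [mul_add]; exact Submodule.add_mem _ hx hy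
  | smul c x _ hx => rw [mul_smul_comm]; exact Submodule.smul_mem _ c hx
  | mem x hx =>
    obtain ⟨u, v, c, habc, rfl⟩ := hx
    have hs : ∀ u v c, u + v + c = a + 1 → facP K u v * X 2 ^ c ∈ facSpan K (a+1) :=
      fun u v c h => Submodule.subset_span ⟨u, v, c, h, rfl⟩
    fin_cases k
    · have : X 0 * (facP K u v * X 2 ^ c) =
          facP K (u+1) v * X 2 ^ c + (u : K) • (facP K u v * X 2 ^ (c+1)) := by
        rw [smul_eq_C_mul]; unfold facP; rw [Finset.prod_range_succ]; ring
      change X 0 * (facP K u v * X 2 ^ c) ∈ _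
      rw [this]
      exact Submodule.add_mem _ (hs _ _ _ (by omega)) (Submodule.smul_mem _ _ (hs _ _ _ (by omega)))
    · have : X 1 * (facP K u v * X 2 ^ c) =
          facP K u (v+1) * X 2 ^ c + (v : K) • (facP K u v * X 2 ^ (c+1)) := by
        rw [smul_eq_C_mul]; unfold facP; rw [Finset.prod_range_succ _ v]; ring
      change X 1 * (facP K u v * X 2 ^ c) ∈ _
      rw [this]
      exact Submodule.add_mem _ (hs _ _ _ (by omega)) (Submodule.smul_mem _ _ (hs _ _ _ (by omega)))
    · have : X 2 * (facP K u v * X 2 ^ c) = facP K u v * X 2 ^ (c+1) := by ring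
      change X 2 * (facP K u v * X 2 ^ c) ∈ _
      rw [this]
      exact hs _ _ _ (by omega)

lemma mem_facSpan {a : ℕ} {f : MvPolynomial (Fin 3) K} (hf : f.IsHomogeneous a) :
    f ∈ facSpan K a := by
  induction a generalizing f with
  | zero =>
    refine hom_induction _ (fun s hs => ?_) hf
    rw [Finsupp.degree_eq_zero_iff] at hs
    subst hs
    exact Submodule.subset_span ⟨0, 0, 0, rfl, by simp [facP]⟩
  | succ a ih => exact hom_induction_succ _ (fun k g hg => facSpan_mul k (ih hg)) hf

lemma facSpan_eq (a : ℕ) : homogeneousSubmodule (Fin 3) K a = facSpan K a := by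
  refine le_antisymm (fun f hf => mem_facSpan hf) (Submodule.span_le.mpr ?_)
  rintro _ ⟨u, v, c, h, rfl⟩
  have := (facP_homog (K := K) u v).mul ((isHomogeneous_X K (2 : Fin 3)).pow c)
  rw [← h]
  simpa using this

/-- evaluation at all points -/
def evP (K : Type*) [Field K] (P : Finset (ℕ × ℕ)) : MvPolynomial (Fin 3) K →ₗ[K] (P → K) :=
  LinearMap.pi fun p => (evp K p.1).toLinearMap

/-- evaluation vectors of the products -/
def evec (K : Type*) [Field K] (P : Finset (ℕ × ℕ)) (q : ℕ × ℕ) : P → K :=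
  fun p => ffac K p.1.1 q.1 * ffac K p.1.2 q.2

lemma evP_fac (P : Finset (ℕ × ℕ)) (u v c : ℕ) :
    evP K P (facP K u v * X 2 ^ c) = evec K P (u, v) := by
  funext p
  exact evp_fac p.1 u v c

lemma evec_indep [CharZero K] (P : Finset (ℕ × ℕ)) :
    LinearIndependent K (fun q : P => evec K P q.1) := by
  rw [Fintype.linearIndependent_iff]
  intro g hg
  have key : ∀ N, ∀ q : P, q.1.1 + q.1.2 = N → g q = 0 := by
    intro N
    induction N using Nat.strong_induction_on with
    | _ N ih =>
      intro q hq
      have h := congrFun hg q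
      rw [Finset.sum_apply, Finset.sum_eq_single q] at h
      · simp only [Pi.smul_apply, Pi.zero_apply, evec, smul_eq_mul] at h
        rcases mul_eq_zero.mp h with h | h
        · exact h
        · exact absurd h (mul_ne_zero (ffac_ne le_rfl) (ffac_ne le_rfl))
      · intro r _ hr
        simp only [Pi.smul_apply, evec, smul_eq_mul]
        by_cases h1 : q.1.1 < r.1.1
        · rw [ffac_zero h1]; simp
        by_cases h2 : q.1.2 < r.1.2
        · rw [ffac_zero h2]; simp
        rw [ih (r.1.1 + r.1.2) ?_ r rfl, zero_mul]
        have : ¬ (r.1.1 = q.1.1 ∧ r.1.2 = q.1.2) := fun h => hr (Subtype.ext (Prod.ext h.1 h.2))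
        omega
      · simp
  exact fun q => key _ q rfl

lemma finrank_evP [CharZero K] (P : Finset (ℕ × ℕ))
    (hP : ∀ u v u' v', (u, v) ∈ P → u' ≤ u → v' ≤ v → (u', v') ∈ P) (a : ℕ) :
    Module.finrank K ((homogeneousSubmodule (Fin 3) K a).map (evP K P)) =
      (P.filter (fun q => q.1 + q.2 ≤ a)).card := by
  have e : (homogeneousSubmodule (Fin 3) K a).map (evP K P) =
      Submodule.span K (Set.range (fun q : {q : P // q.1.1 + q.1.2 ≤ a} => evec K P q.1.1)) := by
    rw [facSpan_eq, facSpan, Submodule.map_span]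
    refine le_antisymm (Submodule.span_le.mpr ?_) (Submodule.span_mono ?_)
    · rintro _ ⟨_, ⟨u, v, c, h, rfl⟩, rfl⟩
      rw [evP_fac]
      by_cases hq : (u, v) ∈ P
      · exact Submodule.subset_span ⟨⟨⟨(u, v), hq⟩, by simp; omega⟩, rfl⟩
      · have : evec K P (u, v) = 0 := by
          funext p
          simp only [evec, Pi.zero_apply]
          by_cases h1 : p.1.1 < u
          · rw [ffac_zero h1, zero_mul]
          by_cases h2 : p.1.2 < v
          · rw [ffac_zero h2, mul_zero]
          exact absurd (hP p.1.1 p.1.2 u v p.2 (by omega) (by omega)) hq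
        rw [this]
        exact Submodule.zero_mem _
    · rintro _ ⟨⟨⟨⟨u, v⟩, hq⟩, h⟩, rfl⟩
      exact ⟨_, ⟨u, v, a - u - v, by simp at h; omega, rfl⟩, evP_fac _ _ _ _⟩
  rw [e, finrank_span_eq_card]
  · rw [Fintype.card_subtype, ← Finset.card_map (Function.Embedding.subtype _)]
    congr 1
    ext ⟨u, v⟩
    simp
    tauto
  · exact (evec_indep P).comp _ Subtype.val_injective

/-- the functional `f ↦ ∑ f_j(p)` -/
def phiP (K : Type*) [Field K] (P : Finset (ℕ × ℕ)) (j : ℕ) : MvPolynomial (Fin 3) K →ₗ[K] K :=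
  (∑ p ∈ P, (evp K p).toLinearMap) ∘ₗ homogeneousComponent j

lemma phiP_comp (P : Finset (ℕ × ℕ)) (j : ℕ) (f : MvPolynomial (Fin 3) K) :
    phiP K P j (homogeneousComponent j f) = phiP K P j f := by
  simp only [phiP, LinearMap.comp_apply]
  rw [homogeneousComponent_eq_self (homogeneousComponent_isHomogeneous j f)]

lemma phiP_apply (P : Finset (ℕ × ℕ)) (j : ℕ) {f : MvPolynomial (Fin 3) K}
    (hf : f.IsHomogeneous j) : phiP K P j f = ∑ p : P, evP K P f p := by
  simp only [phiP, LinearMap.comp_apply]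
  rw [homogeneousComponent_eq_self hf, LinearMap.sum_apply, ← Finset.sum_coe_sort]
  rfl

lemma points_main [CharZero K] (P : Finset (ℕ × ℕ))
    (hP : ∀ u v u' v', (u, v) ∈ P → u' ≤ u → v' ≤ v → (u', v') ∈ P) (hne : P.Nonempty)
    (m j : ℕ) (hm : ∀ q ∈ P, q.1 + q.2 ≤ m) (hmj : 2 * m ≤ j) :
    ∃ I : Ideal (MvPolynomial (Fin 3) K), IsAG 3 K I j ∧ (∃ φ, DualPk I j φ) ∧
      ∀ a ≤ m, hilb 3 K I a = (P.filter (fun q => q.1 + q.2 ≤ a)).card := by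
  have hD := inv_dualPk (phiP_comp (K := K) P j)
  refine ⟨invIdeal (phiP K P j), ?_, ⟨_, hD⟩, ?_⟩
  · have hX : (X 2 ^ j : MvPolynomial (Fin 3) K).IsHomogeneous j := by
      simpa using (isHomogeneous_X K (2 : Fin 3)).pow j
    refine inv_isAG (phiP_comp (K := K) P j) hX ?_
    rw [phiP_apply _ _ hX]
    have : ∀ p : P, evP K P (X 2 ^ j) p = 1 := by
      intro p
      change evp K p.1 (X 2 ^ j) = 1
      simp [evp]
    simp only [this]
    simpa using hne.ne_empty
  · intro a ha
    rw [← finrank_evP (K := K) P hP a]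
    refine finrank_map_eq_of_ker _ _ _ fun f hf => ?_
    have htop : (homogeneousSubmodule (Fin 3) K (j - a)).map (evP K P) = ⊤ := by
      apply Submodule.eq_top_of_finrank_eq
      rw [finrank_evP P hP, Finset.filter_true_of_mem]
      · simp
      · intro q hq
        have := hm q hq
        omega
    have h1 : (Ideal.Quotient.mkₐ K (invIdeal (phiP K P j))).toLinearMap f = 0 ↔
        f ∈ invIdeal (phiP K P j) := Ideal.Quotient.eq_zero_iff_mem
    rw [h1, hD a (j - a) (by omega) f hf]
    have hmul : ∀ g : MvPolynomial (Fin 3) K, g.IsHomogeneous (j - a) →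
        phiP K P j (f * g) = ∑ p, evP K P f p * evP K P g p := by
      intro g hg
      have hfg : (f * g).IsHomogeneous j := by
        have := IsHomogeneous.mul hf hg
        rwa [show a + (j - a) = j by omega] at this
      rw [phiP_apply _ _ hfg]
      refine Finset.sum_congr rfl fun p _ => ?_
      exact map_mul (evp K p.1) f g
    constructor
    · intro h
      funext p
      have hs : Pi.single p (1 : K) ∈ (homogeneousSubmodule (Fin 3) K (j - a)).map (evP K P) := by
        rw [htop]; trivial
      obtain ⟨g, hg, hgp⟩ := hs
      have := h g hg
      rw [hmul g hg, hgp] at this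
      simpa [Pi.single_apply] using this
    · intro h g hg
      rw [hmul g hg, h]
      simp

lemma card_diag (t : ℕ → ℕ) (m : ℕ) (ht : ∀ d, t d ≤ d + 1) (a : ℕ) (ha : a ≤ m) :
    ((((Finset.range (m+1)) ×ˢ (Finset.range (m+1))).filter
      (fun q => q.1 + q.2 ≤ m ∧ q.1 < t (q.1 + q.2))).filter (fun q => q.1 + q.2 ≤ a)).card
      = ∑ d ∈ Finset.range (a+1), t d := by
  rw [Finset.card_eq_sum_card_fiberwise (f := fun q => q.1 + q.2) (t := Finset.range (a+1))]
  · refine Finset.sum_congr rfl fun d hd => ?_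
    have hd' := Finset.mem_range.mp hd
    conv_rhs => rw [← Finset.card_range (t d)]
    refine Finset.card_nbij' (fun q => q.1) (fun u => (u, d - u)) ?_ ?_ ?_ ?_
    · rintro ⟨u, v⟩ h
      simp at h ⊢
      obtain ⟨⟨⟨_, _, h⟩, _⟩, rfl⟩ := h
      exact h
    · intro u hu
      have := ht d
      simp at hu ⊢
      have e : u + (d - u) = d := by omega
      rw [e]
      refine ⟨⟨⟨⟨by omega, by omega⟩, by omega, hu⟩, by omega⟩, rfl⟩
    · rintro ⟨u, v⟩ h
      simp at h ⊢
      omega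
    · intro u hu
      rfl
  · intro q hq
    simp at hq ⊢
    omega

lemma points_seq (K : Type*) [Field K] [CharZero K] (t : ℕ → ℕ) (m j : ℕ) (hmj : 2 * m ≤ j)
    (h0 : t 0 = 1) (ht : ∀ d, t d ≤ d + 1)
    (hs : ∀ d, d < m → t (d+1) ≤ t d ∨ t d = d + 1) :
    ∃ I : Ideal (MvPolynomial (Fin 3) K), IsAG 3 K I j ∧ (∃ φ, DualPk I j φ) ∧
      ∀ a ≤ m, hilb 3 K I a = ∑ d ∈ Finset.range (a+1), t d := by
  have hlow : ∀ u v u' v', (u, v) ∈ (((Finset.range (m+1)) ×ˢ (Finset.range (m+1))).filter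
      (fun q => q.1 + q.2 ≤ m ∧ q.1 < t (q.1 + q.2))) → u' ≤ u → v' ≤ v →
      (u', v') ∈ (((Finset.range (m+1)) ×ˢ (Finset.range (m+1))).filter
      (fun q => q.1 + q.2 ≤ m ∧ q.1 < t (q.1 + q.2))) := by
    have A : ∀ u v x y, u + x + (v + y) ≤ m → u + x < t (u + x + (v + y)) → u < t (u + v) := by
      intro u v x
      induction x with
      | zero =>
        intro y
        induction y with
        | zero => intro _ h; exact h
        | succ y ih =>
          intro h1 h2
          have := hs (u + (v + y)) (by omega)
          simp only [Nat.add_zero, ← Nat.add_assoc] at *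
          exact ih (by omega) (by omega)
      | succ x ih =>
        intro y h1 h2
        have := hs (u + x + (v + y)) (by omega)
        have e : u + (x + 1) + (v + y) = u + x + (v + y) + 1 := by omega
        rw [e] at h2
        exact ih y (by omega) (by omega)
    intro u v u' v' h hu hv
    simp at h ⊢
    obtain ⟨x, rfl⟩ := Nat.exists_eq_add_of_le hu
    obtain ⟨y, rfl⟩ := Nat.exists_eq_add_of_le hv
    have := A u' v' x y (by omega) h.2.2
    refine ⟨⟨by omega, by omega⟩, by omega, this⟩
  obtain ⟨I, h1, h2, h3⟩ := points_main (K := K) _ hlow ⟨(0,0), by simp [h0]⟩ m j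
    (fun q hq => by simp at hq; exact hq.2.1) hmj
  exact ⟨I, h1, h2, fun a ha => by rw [h3 a ha, card_diag t m ht a ha]⟩
end pts


lemma macB_full (d : ℕ) : d + 3 ≤ macB (d + 2) (d + 1) := by
  rw [macB, if_neg (by omega)]
  have h : d + 2 ≤ Nat.findGreatest (fun k => Nat.choose k (d+1) ≤ d + 2) (d + 2 + d + 1) := by
    apply Nat.le_findGreatest (by omega)
    rw [Nat.choose_succ_self_right]
  have h2 := Nat.choose_le_choose (d+2) (Nat.succ_le_succ h)
  rw [show (d + 2).succ = (d + 2) + 1 from rfl, Nat.choose_succ_self_right] at h2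
  refine le_trans ?_ (Nat.le_add_right _ _)
  exact h2

lemma le_macB (d : ℕ) : ∀ c, c ≤ d → c ≤ macB c d := by
  induction d with
  | zero => intro c hc; omega
  | succ e ih =>
    intro c hc
    rcases Nat.eq_zero_or_pos c with rfl | hpos
    · omega
    rw [macB, if_neg (by omega)]
    have h1 : e + 1 ≤ Nat.findGreatest (fun k => Nat.choose k (e+1) ≤ c) (c + e + 1) := by
      apply Nat.le_findGreatest (by omega)
      rw [Nat.choose_self]; exact hpos
    have h2 : Nat.choose (Nat.findGreatest (fun k => Nat.choose k (e+1) ≤ c) (c + e + 1)) (e+1) ≤ c :=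
      Nat.findGreatest_spec (P := fun k => Nat.choose k (e+1) ≤ c) (m := e + 1) (by omega)
        (by rw [Nat.choose_self]; exact hpos)
    have h3 : Nat.findGreatest (fun k => Nat.choose k (e+1) ≤ c) (c + e + 1) = e + 1 := by
      by_contra hne
      have := Nat.choose_le_choose (e+1)
        (show e + 2 ≤ Nat.findGreatest (fun k => Nat.choose k (e+1) ≤ c) (c + e + 1) by omega)
      rw [Nat.choose_succ_self_right] at this
      omega
    simp only [h3, Nat.choose_self]
    have := ih (c - 1) (by omega)
    omega

/-- Let `A = R/I` be a graded Artinian Gorenstein quotient of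
`R = K[w,x,y,z]` of socle degree `j ≥ 4` with `I_1 = 0` and
`I_2 = ⟨w², wx, wy⟩`, and let `H = H(A)`.  Then (1) `ΔH_{≤ j/2}` is an
O-sequence, and (2) `H = H' + (0,1,...,1,0)` for some height three Gorenstein
sequence `H'` of socle degree `j`. -/
theorem statement_13 {K : Type*} [Field K] [IsAlgClosed K] [CharZero K]
    (j : ℕ) (hj : 4 ≤ j) (I : Ideal (MvPolynomial (Fin 4) K))
    (hI : IsAG 4 K I j)
    (hI1 : ∀ f ∈ I, f.IsHomogeneous 1 → f = 0)
    (hI2 : Submodule.restrictScalars K I ⊓ homogeneousSubmodule (Fin 4) K 2 =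
      Submodule.span K {X 0 ^ 2, X 0 * X 1, X 0 * X 2}) :
    DeltaOSeq (hilb 4 K I) (j / 2) ∧
    ∃ I' : Ideal (MvPolynomial (Fin 3) K), IsAG 3 K I' j ∧
      hilb 4 K I 0 = 1 ∧ hilb 3 K I' 0 = 1 ∧
      hilb 4 K I j = 1 ∧ hilb 3 K I' j = 1 ∧
      ∀ i, 1 ≤ i → i ≤ j - 1 → hilb 4 K I i = hilb 3 K I' i + 1 := by
  obtain ⟨H1, H2, hnum⟩ := num_main hj hI hI1 hI2
  obtain ⟨φ, hD⟩ := exists_dualPk hI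
  obtain ⟨H0, Hj⟩ := hilb_ends hD hI.2.2.2.1
  set H := hilb 4 K I with hH
  have hb : ∀ e, 2 * (e + 2) ≤ j → H (e+2) ≤ H (e+1) + (e + 3) := by
    intro e
    induction e with
    | zero => intro _; simp only [Nat.zero_add]; omega
    | succ e ih =>
      intro he
      have := ih (by omega)
      have := hnum e (by omega)
      simp only [show e + 1 + 2 = e + 3 by ring, show e + 1 + 1 = e + 2 by ring]
      omega
  refine ⟨⟨?_, ?_, ?_⟩, ?_⟩
  · intro i h1 h2
    rcases Nat.lt_or_ge i 2 with h | h
    · obtain rfl : i = 1 := by omega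
      simp [H0, H1]
    · obtain ⟨e, rfl⟩ := Nat.exists_eq_add_of_le' h
      exact (hnum e (by omega)).1
  · simp
  · intro i h1 h2
    rcases Nat.lt_or_ge i 2 with h | h
    · obtain rfl : i = 1 := by omega
      simp [H0, H1, H2, macB, Nat.findGreatest, Nat.choose]
    · obtain ⟨e, rfl⟩ := Nat.exists_eq_add_of_le' h
      have h3 := hnum e (by omega)
      have h4 := hb e (by omega)
      simp only [show e + 2 + 1 = e + 3 by ring, Nat.add_eq_zero_iff, show e + 3 - 1 = e + 2 by omega,
        show e + 2 - 1 = e + 1 by omega, if_neg (show ¬ (e = 0 ∧ 2 = 0) by omega),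
        if_neg (show ¬ (e = 0 ∧ 3 = 0) by omega)]
      by_cases hc : H (e+2) - H (e+1) = e + 3
      · rw [hc]
        refine le_trans ?_ (macB_full (e+1))
        omega
      · refine le_trans ?_ (le_macB (e+2) _ (by omega))
        omega
  · obtain ⟨I', hAG, ⟨φ', hD'⟩, hs⟩ := points_seq K
      (fun d => if d = 0 then 1 else if d = 1 then 2 else if d ≤ j / 2 then H d - H (d-1) else 0)
      (j/2) j (by omega) (by simp) (by
        intro d
        split_ifs with h1 h2 h3
        · omega
        · omega
        · obtain ⟨e, rfl⟩ := Nat.exists_eq_add_of_le' (show 2 ≤ d by omega)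
          have h4 := hb e (by omega)
          rw [show e + 2 - 1 = e + 1 by omega]
          omega
        · omega) (by
        intro d hd
        rcases Nat.lt_or_ge d 2 with h | h
        · right
          obtain rfl | rfl : d = 0 ∨ d = 1 := by omega
          · simp
          · simp
        · obtain ⟨e, rfl⟩ := Nat.exists_eq_add_of_le' h
          have h3 := hnum e (by omega)
          have h4 := hb e (by omega)
          rw [if_neg (by omega), if_neg (by omega), if_pos (by omega), if_neg (by omega),
            if_neg (by omega), if_pos (by omega), show e + 2 + 1 - 1 = e + 2 by omega,
            show e + 2 - 1 = e + 1 by omega, show e + 2 + 1 = e + 3 by omega]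
          omega)
    obtain ⟨H0', Hj'⟩ := hilb_ends hD' hAG.2.2.2.1
    have key : ∀ a, a + 1 ≤ j / 2 → H (a+1) = hilb 3 K I' (a+1) + 1 := by
      intro a
      induction a with
      | zero =>
        intro h
        rw [hs _ h]
        simp [Finset.sum_range_succ, H1]
      | succ a ih =>
        intro h
        have h1 := ih (by omega)
        rw [hs _ (by omega)] at h1
        rw [hs _ h, Finset.sum_range_succ, if_neg (by omega), if_neg (by omega), if_pos h]
        have := (hnum a (by omega)).1
        simp only [show a + 1 + 1 = a + 2 by ring, show a + 2 - 1 = a + 1 by omega] at *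
        omega
    refine ⟨I', hAG, H0, H0', Hj, Hj', ?_⟩
    intro i h1 h2
    rcases Nat.lt_or_ge (j/2) i with h | h
    · have e1 := hilb_symm hD (show i + (j - i) = j by omega)
      have e2 := hilb_symm hD' (show i + (j - i) = j by omega)
      rw [← hH] at e1
      have := key (j - i - 1) (by omega)
      rw [show j - i - 1 + 1 = j - i by omega] at this
      omega
    · have := key (i - 1) (by omega)
      rwa [show i - 1 + 1 = i by omega] at this


end
end

section
/- Let H = (h_0, …, h_j) be a Gorenstein sequence of socle degree j ≥ 6 with h_0 = 1, h_1 = 4, h_2 = 7, and set h = h_3, b = h_4. Then 7 ≤ h ≤ 11, and if j ≥ 7 then h ≤ b ≤ b_max(h), where b_max(7) = 7, b_max(8) = 9, b_max(9) = 11, b_max(10) = 13, b_max(11) = 16. Equivalently, the sequence (1, 3, 3, h−7, b−h) of first differences ΔH_{≤4} is an O-sequence. -/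
open MvPolynomial

noncomputable section

/-- The maximal value `b_max(h)` of `h_4` for a Gorenstein sequence
`(1,4,7,h,b,...)` with `j ≥ 7`. -/
def bmax (h : ℕ) : ℕ :=
  if h = 7 then 7 else if h = 8 then 9 else if h = 9 then 11 else
    if h = 10 then 13 else 16

/-- An integer-valued O-sequence `(t_0,...,t_m)`: `t_0 = 1`, all terms
nonnegative, and `t_{i+1} ≤ t_i^{(i)}` for `1 ≤ i ≤ m-1`. -/
def IsOSeqZ (t : ℕ → ℤ) (m : ℕ) : Prop :=
  t 0 = 1 ∧ (∀ i ≤ m, 0 ≤ t i) ∧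
    ∀ i, 1 ≤ i → i + 1 ≤ m → t (i + 1) ≤ (macB (t i).toNat i : ℤ)

section lin
variable {K : Type*} [Field K] {U W : Type*} [AddCommGroup U] [Module K U] [AddCommGroup W] [Module K W]

lemma li_cofin [Infinite K] {ι : Type*} [Fintype ι] (u w : ι → W) (h : LinearIndependent K u) :
    {t : K | ¬ LinearIndependent K (fun i => u i + t • w i)}.Finite := by
  classical
  obtain ⟨g, hg⟩ := (Fintype.linearCombination K u).exists_leftInverse_of_injective
    (by rw [LinearMap.ker_eq_bot]; exact h.fintypeLinearCombination_injective)
  let M : Matrix ι ι (Polynomial K) := fun i k => Polynomial.C (g (u i) k) + Polynomial.X * Polynomial.C (g (w i) k)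
  have ev : ∀ t, (M.det).eval t = Matrix.det (fun i k => g (u i + t • w i) k) := by
    intro t
    rw [← Polynomial.coe_evalRingHom, RingHom.map_det]
    congr 1
    ext i k
    change Polynomial.eval t (M i k) = _
    simp [M]
    ring
  have hu : ∀ i, g (u i) = Pi.single i 1 := by
    intro i
    have := LinearMap.congr_fun hg (Pi.single i 1)
    simpa [Fintype.linearCombination_apply_single] using this
  have hne : M.det ≠ 0 := by
    intro h0
    have := ev 0
    rw [h0] at this
    have h1 : Matrix.det (fun i k => g (u i + (0:K) • w i) k) = 1 := by
      rw [← Matrix.det_one (n := ι) (R := K)]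
      congr 1
      ext i k
      simp [hu, Matrix.one_apply, Pi.single_apply, eq_comm]
    rw [h1] at this
    simp at this
  refine (Polynomial.finite_setOfPred_isRoot hne).subset ?_
  intro t ht
  by_contra hr
  apply ht
  have hdet : Matrix.det (fun i k => g (u i + t • w i) k) ≠ 0 := by
    rw [← ev]; exact hr
  have := Matrix.linearIndependent_rows_of_det_ne_zero hdet
  exact LinearIndependent.of_comp g this

lemma rank_cofin [Infinite K] [FiniteDimensional K U] (P Q : U →ₗ[K] W) (z : W)
    (hz : z ∉ LinearMap.range P) 
    (hmax : ∀ t : K, Module.finrank K (LinearMap.range (P + t • Q)) ≤ Module.finrank K (LinearMap.range P)) :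
    {t : K | z ∈ LinearMap.range (P + t • Q)}.Finite := by
  classical
  let b := Module.finBasis K (LinearMap.range P)
  choose u hu using fun i => (LinearMap.mem_range.1 (b i).2)
  have hli : LinearIndependent K (fun o : Option (Fin (Module.finrank K (LinearMap.range P))) => o.elim z (fun i => P (u i))) := by
    have h1 : LinearIndependent K (fun i => P (u i)) := by
      have := b.linearIndependent.map' (LinearMap.range P).subtype (by simp)
      have e : (fun i => P (u i)) = (LinearMap.range P).subtype ∘ b := by
        ext i; simp [hu]
      rw [e]; exact this
    rw [linearIndependent_option]
    refine ⟨h1, fun hm => hz ?_⟩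
    refine (Submodule.span_le.2 ?_) hm
    rintro _ ⟨i, rfl⟩
    exact ⟨u i, rfl⟩
  refine (li_cofin _ (fun o => o.elim 0 (fun i => Q (u i))) hli).subset ?_
  intro t ht hli'
  rw [linearIndependent_option] at hli'
  obtain ⟨h1, h2⟩ := hli'
  apply h2
  change LinearIndependent K (fun i => P (u i) + t • Q (u i)) at h1
  have : Submodule.span K (Set.range fun i => P (u i) + t • Q (u i)) = LinearMap.range (P + t • Q) := by
    apply Submodule.eq_of_le_of_finrank_le
    · rw [Submodule.span_le]
      rintro _ ⟨i, rfl⟩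
      exact ⟨u i, rfl⟩
    · refine (hmax t).trans ?_
      rw [finrank_span_eq_card h1]; simp
  simpa [Function.comp_def, this] using ht

lemma rank_cofin' [Infinite K] [FiniteDimensional K U] (P Q : U →ₗ[K] W) (r : ℕ)
    (hr : r ≤ Module.finrank K (LinearMap.range P)) :
    {t : K | Module.finrank K (LinearMap.range (P + t • Q)) < r}.Finite := by
  classical
  let b := Module.finBasis K (LinearMap.range P)
  choose u hu using fun i => (LinearMap.mem_range.1 (b i).2)
  have h1 : LinearIndependent K (fun i => P (u i)) := by
    have := b.linearIndependent.map' (LinearMap.range P).subtype (by simp)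
    have e : (fun i => P (u i)) = (LinearMap.range P).subtype ∘ b := by
      ext i; simp [hu]
    rw [e]; exact this
  refine (li_cofin _ (fun i => Q (u i)) h1).subset ?_
  intro t ht hli'
  have h3 : Submodule.span K (Set.range fun i => P (u i) + t • Q (u i)) ≤ LinearMap.range (P + t • Q) := by
    rw [Submodule.span_le]
    rintro _ ⟨i, rfl⟩
    exact ⟨u i, rfl⟩
  have h4 := Submodule.finrank_mono h3
  rw [finrank_span_eq_card hli'] at h4
  simp at h4 ht
  omega

/-- polynomial curve in a subspace -/
lemma curve_mem (N : Submodule K W) (n : ℕ) (c : ℕ → W) (S : Set K) (hS : S.Infinite)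
    (h : ∀ t ∈ S, ∑ k ∈ Finset.range n, t ^ k • c k ∈ N) (k : ℕ) (hk : k < n) : c k ∈ N := by
  by_contra hc
  obtain ⟨φ, h1, h2⟩ := Submodule.exists_le_ker_of_notMem hc
  let p : Polynomial K := ∑ k ∈ Finset.range n, Polynomial.monomial k (φ (c k))
  have hp : p = 0 := by
    apply Polynomial.eq_zero_of_infinite_isRoot
    refine hS.mono ?_
    intro t ht
    have := h2 (h t ht)
    simp only [LinearMap.mem_ker, map_sum, map_smul, smul_eq_mul] at this
    simp only [p, Set.mem_ofPred_eq, Polynomial.IsRoot, Polynomial.eval_finsetSum, Polynomial.eval_monomial]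
    rw [← this]
    exact Finset.sum_congr rfl fun _ _ => mul_comm _ _
  apply h1
  have := congrArg (fun q => q.coeff k) hp
  simpa [p, Polynomial.coeff_monomial, hk] using this

lemma finrank_flip [FiniteDimensional K U] [FiniteDimensional K W] (B : U →ₗ[K] W →ₗ[K] K) :
    Module.finrank K (LinearMap.range B) = Module.finrank K (LinearMap.range B.flip) := by
  have : B.flip = B.dualMap ∘ₗ (Module.evalEquiv K W).toLinearMap := by
    ext; simp
  rw [this, LinearMap.range_comp_of_range_eq_top _ (LinearEquiv.range _),
    LinearMap.finrank_range_dualMap_eq_finrank_range]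

end lin


section alg
variable {K A : Type*} [Field K] [CommRing A] [Algebra K A]

/-- the subspace `L * U` -/
def mr (L : A) (U : Submodule K A) : Submodule K A := U.map (LinearMap.mulLeft K L)

lemma mem_mr {L : A} {U : Submodule K A} {z : A} : z ∈ mr L U ↔ ∃ u ∈ U, L * u = z := by
  simp [mr]

lemma mr_le {L : A} {V : Submodule K A} {m : ℕ} (hL : L ∈ V) : mr L (V ^ m) ≤ V ^ (m + 1) := by
  intro z hz
  obtain ⟨u, hu, rfl⟩ := mem_mr.1 hz
  rw [pow_succ']
  exact Submodule.mul_mem_mul hL hu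

lemma V_mul_mr {L : A} {V : Submodule K A} {m : ℕ} : V * mr L (V ^ m) ≤ mr L (V ^ (m + 1)) := by
  rw [Submodule.mul_le]
  intro v hv z hz
  obtain ⟨u, hu, rfl⟩ := mem_mr.1 hz
  refine mem_mr.2 ⟨v * u, ?_, by ring⟩
  rw [pow_succ']
  exact Submodule.mul_mem_mul hv hu

lemma pow_span_aux [CharZero K] (V N : Submodule K A) : ∀ (m : ℕ) (w : A), (∀ y ∈ V, y ^ m * w ∈ N) →
    ∀ x ∈ V ^ m, x * w ∈ N := by
  intro m
  induction m with
  | zero =>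
    intro w h x hx
    rw [pow_zero, Submodule.mem_one] at hx
    obtain ⟨c, rfl⟩ := hx
    have := h 0 V.zero_mem
    rw [← Algebra.smul_def]
    exact N.smul_mem _ (by simpa using this)
  | succ m ih =>
    intro w h x hx
    have key : ∀ z ∈ V, ∀ y ∈ V, y ^ m * (z * w) ∈ N := by
      intro z hz y hy
      have := curve_mem N (m + 2) (fun k => ((m+1).choose k : K) • (z ^ k * y ^ (m + 1 - k) * w)) Set.univ
        Set.infinite_univ (by
          intro t _
          have h1 := h (t • z + y) (V.add_mem (V.smul_mem _ hz) hy)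
          rw [add_pow, Finset.sum_mul] at h1
          convert h1 using 1
          refine Finset.sum_congr rfl fun k _ => ?_
          simp only [smul_pow, Algebra.smul_def, map_pow, map_natCast]
          ring) 1 (by omega)
      simp only [Nat.choose_one_right, pow_one, Nat.add_sub_cancel] at this
      have h2 := N.smul_mem (((m + 1 : ℕ) : K)⁻¹) this
      rw [smul_smul, inv_mul_cancel₀ (by exact_mod_cast Nat.succ_ne_zero m), one_smul] at h2
      convert h2 using 1
      ring
    rw [pow_succ] at hx
    refine Submodule.mul_induction_on hx ?_ ?_
    · intro a ha z hz
      rw [mul_assoc]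
      exact ih _ (key z hz) a ha
    · intro a b ha hb
      rw [add_mul]
      exact N.add_mem ha hb

lemma pow_span [CharZero K] (V N : Submodule K A) (m : ℕ) (h : ∀ y ∈ V, y ^ m ∈ N) : V ^ m ≤ N := by
  intro x hx
  simpa using pow_span_aux V N m 1 (by simpa using h) x hx

/-- `(n,u) ↦ n + L u` -/
def addMap (N U : Submodule K A) (L : A) : (N × U) →ₗ[K] A :=
  N.subtype.coprod (LinearMap.mulLeft K L ∘ₗ U.subtype)

lemma range_addMap (N U : Submodule K A) (L : A) : LinearMap.range (addMap N U L) = N ⊔ mr L U := by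
  rw [addMap, LinearMap.range_coprod, LinearMap.range_comp]
  simp [mr]

lemma addMap_line (N U : Submodule K A) (L y : A) (t : K) :
    addMap N U (L + t • y) = addMap N U L + t • ((0 : N →ₗ[K] A).coprod (LinearMap.mulLeft K y ∘ₗ U.subtype)) := by
  ext <;> simp [addMap, add_mul]

variable [FiniteDimensional K A]

lemma cofinA [Infinite K] (N U : Submodule K A) (L y z : A) (hz : z ∉ N ⊔ mr L U)
    (hmax : ∀ t : K, Module.finrank K ↥(N ⊔ mr (L + t • y) U) ≤ Module.finrank K ↥(N ⊔ mr L U)) :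
    {t : K | z ∈ N ⊔ mr (L + t • y) U}.Finite := by
  have := rank_cofin (addMap N U L) ((0 : N →ₗ[K] A).coprod (LinearMap.mulLeft K y ∘ₗ U.subtype)) z
    (by rwa [range_addMap]) (by intro t; rw [← addMap_line, range_addMap, range_addMap]; exact hmax t)
  simpa only [← addMap_line, range_addMap] using this

lemma cofinB [Infinite K] (N U : Submodule K A) (L y : A) (r : ℕ) (hr : r ≤ Module.finrank K ↥(N ⊔ mr L U)) :
    {t : K | Module.finrank K ↥(N ⊔ mr (L + t • y) U) < r}.Finite := by
  have := rank_cofin' (addMap N U L) ((0 : N →ₗ[K] A).coprod (LinearMap.mulLeft K y ∘ₗ U.subtype)) r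
    (by rwa [range_addMap])
  refine this.subset fun t ht => ?_
  rw [Set.mem_ofPred_eq, ← addMap_line, range_addMap]
  exact ht

lemma diff_mem (V : Submodule K A) (m : ℕ) (L y : A) (hL : L ∈ V) (hy : y ∈ V) (t : K) : 
    ∀ (a b : ℕ) (x : A), a + b = m + 1 → x ∈ V ^ b →
    L ^ a * x - (-t) ^ a • (y ^ a * x) ∈ mr (L + t • y) (V ^ m) := by
  intro a
  induction a with
  | zero => intro b x _ _; simp
  | succ a ih =>
    intro b x hab hx
    have h1 := ih (b + 1) (L * x) (by omega) (by rw [pow_succ']; exact Submodule.mul_mem_mul hL hx)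
    have h2 : (L + t • y) * ((-t) ^ a • (y ^ a * x)) ∈ mr (L + t • y) (V ^ m) := by
      refine mem_mr.2 ⟨_, Submodule.smul_mem _ _ ?_, rfl⟩
      have : m = a + b := by omega
      rw [this, pow_add]
      exact Submodule.mul_mem_mul (Submodule.pow_mem_pow _ hy _) hx
    convert Submodule.add_mem _ h1 h2 using 1
    simp only [Algebra.smul_def, map_pow, map_neg]
    ring

lemma lemD (V N : Submodule K A) (m : ℕ) (L y : A) (hL : L ∈ V) (hy : y ∈ V) (S : Set K) (hS : S.Infinite)
    (h : ∀ t ∈ S, y ^ (m + 1) ∉ N ⊔ mr (L + t • y) (V ^ m)) (c : ℕ → K)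
    (hc : ∑ a ∈ Finset.range (m + 2), c a • (L ^ a * y ^ (m + 1 - a)) ∈ N) :
    ∀ a < m + 2, c a = 0 := by
  have key : ∀ t ∈ S, ∑ a ∈ Finset.range (m + 2), t ^ a • ((-1) ^ a * c a) ∈ (⊥ : Submodule K K) := by
    intro t ht
    rw [Submodule.mem_bot]
    by_contra hne
    apply h t ht
    set s := ∑ a ∈ Finset.range (m + 2), t ^ a • ((-1) ^ a * c a) with hs
    have h1 : ∑ a ∈ Finset.range (m + 2), c a • (L ^ a * y ^ (m + 1 - a)) - s • y ^ (m + 1) ∈ 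
        mr (L + t • y) (V ^ m) := by
      rw [hs, Finset.sum_smul, ← Finset.sum_sub_distrib]
      refine Submodule.sum_mem _ fun a ha => ?_
      have ha' : a < m + 2 := Finset.mem_range.1 ha
      have h2 := diff_mem V m L y hL hy t a (m + 1 - a) (y ^ (m + 1 - a)) (by omega) 
        (Submodule.pow_mem_pow _ hy _)
      convert Submodule.smul_mem _ (c a) h2 using 1
      rw [← pow_add, show a + (m + 1 - a) = m + 1 by omega, smul_sub, smul_smul]
      congr 2
      rw [neg_pow, smul_eq_mul]; ring
    have h3 : s • y ^ (m + 1) ∈ N ⊔ mr (L + t • y) (V ^ m) := by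
      have := Submodule.sub_mem (N ⊔ mr (L + t • y) (V ^ m)) (Submodule.mem_sup_left hc) (Submodule.mem_sup_right h1)
      simpa using this
    have := Submodule.smul_mem _ s⁻¹ h3
    rwa [smul_smul, inv_mul_cancel₀ hne, one_smul] at this
  intro a ha
  have := curve_mem _ (m + 2) (fun a => (-1) ^ a * c a) S hS key a ha
  simpa using this

lemma exists_max {α : Type*} (p : α → Prop) (f : α → ℕ) (B : ℕ) (hB : ∀ a, f a ≤ B) (hp : ∃ a, p a) :
    ∃ a, p a ∧ ∀ b, p b → f b ≤ f a := by
  obtain ⟨a, ha, hm⟩ := Nat.sSup_mem (s := f '' {a | p a}) (by obtain ⟨a, ha⟩ := hp; exact ⟨_, a, ha, rfl⟩)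
    ⟨B, by rintro _ ⟨a, _, rfl⟩; exact hB a⟩
  refine ⟨a, ha, fun b hb => ?_⟩
  rw [hm]
  exact le_csSup ⟨B, by rintro _ ⟨a, _, rfl⟩; exact hB a⟩ ⟨b, hb, rfl⟩

lemma lemA [CharZero K] (V N : Submodule K A) (m : ℕ) (hN : N ≤ V ^ (m + 1)) 
    (h : ∀ L ∈ V, N ⊔ mr L (V ^ m) ≠ V ^ (m + 1)) :
    Module.finrank K N + (m + 2) ≤ Module.finrank K ↥(V ^ (m + 1)) := by
  obtain ⟨L, hL, hmax⟩ := exists_max (fun L => L ∈ V) (fun L => Module.finrank K ↥(N ⊔ mr L (V ^ m)))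
    (Module.finrank K A) (fun a => Submodule.finrank_le _) ⟨0, V.zero_mem⟩
  have hle : N ⊔ mr L (V ^ m) ≤ V ^ (m + 1) := sup_le hN (mr_le hL)
  obtain ⟨y, hy, hyn⟩ : ∃ y ∈ V, y ^ (m + 1) ∉ N ⊔ mr L (V ^ m) := by
    by_contra! hh
    exact h L hL (le_antisymm hle (pow_span V _ _ hh))
  have hfin := cofinA N (V ^ m) L y _ hyn (fun t => hmax _ (V.add_mem hL (V.smul_mem _ hy)))
  have hD := lemD V N m L y hL hy _ hfin.infinite_compl (fun t ht => ht)
  let v : Fin (m + 2) → A := fun a => L ^ (a : ℕ) * y ^ (m + 1 - a)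
  let Φ : (N × (Fin (m + 2) → K)) →ₗ[K] A := N.subtype.coprod (Fintype.linearCombination K v)
  have hΦ : Function.Injective Φ := by
    rw [← LinearMap.ker_eq_bot, Submodule.eq_bot_iff]
    rintro ⟨n, c⟩ hnc
    have h1 : (n : A) + ∑ a, c a • v a = 0 := by simpa [Φ, Fintype.linearCombination_apply] using hnc
    let c' : ℕ → K := fun a => if ha : a < m + 2 then c ⟨a, ha⟩ else 0
    have h2 : ∑ a ∈ Finset.range (m + 2), c' a • (L ^ a * y ^ (m + 1 - a)) = ∑ a, c a • v a := by
      rw [Finset.sum_range]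
      refine Finset.sum_congr rfl fun a _ => ?_
      simp [c', v]
    have h3 := hD c' (by
      rw [h2, show ∑ a, c a • v a = -(n : A) from (neg_eq_of_add_eq_zero_right h1).symm]
      exact N.neg_mem n.2)
    have h4 : c = 0 := by
      ext a
      have := h3 a a.2
      simpa [c'] using this
    subst h4
    simpa using h1
  have hr : LinearMap.range Φ ≤ V ^ (m + 1) := by
    rw [LinearMap.range_coprod, Submodule.range_subtype, Fintype.range_linearCombination]
    refine sup_le hN (Submodule.span_le.2 ?_)
    rintro _ ⟨a, rfl⟩
    have : m + 1 = a + (m + 1 - a) := by omega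
    change L ^ (a : ℕ) * y ^ (m + 1 - a) ∈ V ^ (m + 1)
    rw [this, pow_add V]
    convert Submodule.mul_mem_mul (Submodule.pow_mem_pow _ hL _) (Submodule.pow_mem_pow _ hy _) using 2
    congr 1; omega
  have := Submodule.finrank_mono hr
  rw [LinearMap.finrank_range_of_inj hΦ] at this
  simpa using this

lemma lemG [CharZero K] (V : Submodule K A) 
    (h : ∀ L ∈ V, ∀ M ∈ V, mr L (V ^ 3) ⊔ mr M (V ^ 3) ≠ V ^ 4) :
    15 ≤ Module.finrank K ↥(V ^ 4) := by
  obtain ⟨⟨L, M⟩, ⟨hL, hM⟩, hmax⟩ := exists_max (fun p : A × A => p.1 ∈ V ∧ p.2 ∈ V) 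
    (fun p => Module.finrank K ↥(mr p.1 (V ^ 3) ⊔ mr p.2 (V ^ 3)))
    (Module.finrank K A) (fun a => Submodule.finrank_le _) ⟨0, V.zero_mem, V.zero_mem⟩
  dsimp only at hL hM hmax
  have hle : mr L (V ^ 3) ⊔ mr M (V ^ 3) ≤ V ^ 4 := sup_le (mr_le hL) (mr_le hM)
  obtain ⟨y, hy, hyn⟩ : ∃ y ∈ V, y ^ 4 ∉ mr L (V ^ 3) ⊔ mr M (V ^ 3) := by
    by_contra! hh
    exact h L hL M hM (le_antisymm hle (pow_span V _ _ hh))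
  have hyn' : y ^ 4 ∉ mr M (V ^ 3) ⊔ mr L (V ^ 3) := by rwa [sup_comm]
  have hfin := cofinA (mr M (V ^ 3)) (V ^ 3) L y _ hyn' (fun t => by
    have := hmax (L + t • y, M) ⟨(V.add_mem hL (V.smul_mem _ hy)), hM⟩
    dsimp only at this
    rwa [sup_comm, sup_comm (mr M (V ^ 3))])
  have hfin2 := cofinB (mr M (V ^ 3)) (V ^ 3) L y (Module.finrank K ↥(mr L (V ^ 3) ⊔ mr M (V ^ 3))) 
    (by rw [sup_comm])
  have hD : ∀ s ∈ ({t : K | y ^ 4 ∈ mr M (V ^ 3) ⊔ mr (L + t • y) (V ^ 3)} ∪ 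
      {t : K | Module.finrank K ↥(mr M (V ^ 3) ⊔ mr (L + t • y) (V ^ 3)) < 
        Module.finrank K ↥(mr L (V ^ 3) ⊔ mr M (V ^ 3))})ᶜ, 
      ∀ c : ℕ → K, ∑ a ∈ Finset.range 5, c a • (M ^ a * y ^ (4 - a)) ∈ mr (L + s • y) (V ^ 3) → 
        ∀ a < 5, c a = 0 := by
    intro s hs
    have hs' : y ^ 4 ∉ mr M (V ^ 3) ⊔ mr (L + s • y) (V ^ 3) ∧ ¬ (Module.finrank K ↥(mr M (V ^ 3) ⊔ mr (L + s • y) (V ^ 3)) < 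
        Module.finrank K ↥(mr L (V ^ 3) ⊔ mr M (V ^ 3))) := by
      constructor
      · intro hh; exact hs (Or.inl hh)
      · intro hh; exact hs (Or.inr hh)
    obtain ⟨hs1, hs2⟩ := hs'
    have hLs : L + s • y ∈ V := V.add_mem hL (V.smul_mem _ hy)
    have hfin3 := cofinA (mr (L + s • y) (V ^ 3)) (V ^ 3) M y (y ^ 4) (by rwa [sup_comm]) (fun t => by
      have := hmax (L + s • y, M + t • y) ⟨hLs, (V.add_mem hM (V.smul_mem _ hy))⟩
      dsimp only at this
      rw [sup_comm (mr (L + s • y) (V ^ 3)) (mr M (V ^ 3))]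
      omega)
    exact lemD V (mr (L + s • y) (V ^ 3)) 3 M y hM hy _ hfin3.infinite_compl (fun t ht => ht)
  have hS := (hfin.union hfin2).infinite_compl
  set S := ({t : K | y ^ 4 ∈ mr M (V ^ 3) ⊔ mr (L + t • y) (V ^ 3)} ∪ 
      {t : K | Module.finrank K ↥(mr M (V ^ 3) ⊔ mr (L + t • y) (V ^ 3)) < 
        Module.finrank K ↥(mr L (V ^ 3) ⊔ mr M (V ^ 3))})ᶜ
  let T : Finset (Σ _ : ℕ, ℕ) := Finset.sigma (Finset.range 5) (fun b => Finset.range (5 - b))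
  let v : (Σ _ : ℕ, ℕ) → A := fun p => L ^ p.2 * (M ^ p.1 * y ^ (4 - p.1 - p.2))
  have hx : ∀ b a : ℕ, a + b ≤ 4 → M ^ b * y ^ (4 - b - a) ∈ V ^ (4 - a) := by
    intro b a hab
    have : 4 - a = b + (4 - b - a) := by omega
    rw [this, pow_add]
    exact Submodule.mul_mem_mul (Submodule.pow_mem_pow _ hM _) (Submodule.pow_mem_pow _ hy _)
  have hli : LinearIndepOn K v (T : Set (Σ _ : ℕ, ℕ)) := by
    rw [linearIndepOn_finset_iff]
    intro f hf
    rw [Finset.sum_sigma] at hf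
    have h1 : ∀ s ∈ S, ∀ b < 5, ∑ a ∈ Finset.range (5 - b), s ^ a • ((-1) ^ a * f ⟨b, a⟩) = 0 := by
      intro s hs
      apply hD s hs
      rw [← Submodule.neg_mem_iff, ← zero_sub, ← hf, ← Finset.sum_sub_distrib]
      refine Submodule.sum_mem _ fun b hb => ?_
      rw [Finset.sum_smul, ← Finset.sum_sub_distrib]
      refine Submodule.sum_mem _ fun a ha => ?_
      rw [Finset.mem_range] at ha hb
      have h2 := diff_mem V 3 L y hL hy s a (4 - a) (M ^ b * y ^ (4 - b - a)) (by omega) (hx b a (by omega))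
      convert Submodule.smul_mem _ (f ⟨b, a⟩) h2 using 1
      rw [smul_sub, smul_smul]
      congr 1
      rw [show y ^ a * (M ^ b * y ^ (4 - b - a)) = M ^ b * (y ^ a * y ^ (4 - b - a)) by ring, ← pow_add,
        show a + (4 - b - a) = 4 - b by omega]
      congr 1
      rw [neg_pow, smul_eq_mul]; ring
    rintro ⟨b, a⟩ hba
    simp only [T, Finset.mem_sigma, Finset.mem_range] at hba
    have := curve_mem (⊥ : Submodule K K) (5 - b) (fun a => (-1) ^ a * f ⟨b, a⟩) S hS 
      (fun s hs => (Submodule.mem_bot K).2 (h1 s hs b hba.1)) a hba.2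
    simpa using this
  have hsp : Submodule.span K (Set.range fun i : (T : Set (Σ _ : ℕ, ℕ)) => v i) ≤ V ^ 4 := by
    rw [Submodule.span_le]
    rintro _ ⟨⟨⟨b, a⟩, hba⟩, rfl⟩
    simp only [T, Finset.coe_sigma, Set.mem_sigma_iff, Finset.mem_coe, Finset.mem_range] at hba
    have : 4 = a + (4 - a) := by omega
    have h2 := Submodule.mul_mem_mul (Submodule.pow_mem_pow _ hL a) (hx b a (by omega))
    rw [← pow_add, ← this] at h2
    exact h2
  have := Submodule.finrank_mono hsp
  rw [finrank_span_eq_card hli] at this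
  have hc : Fintype.card (T : Set (Σ _ : ℕ, ℕ)) = 15 := by
    rw [← Set.toFinset_card, Finset.toFinset_coe]; rfl
  omega

end alg


section alg2
variable {K A : Type*} [Field K] [CommRing A] [Algebra K A] [FiniteDimensional K A]

lemma exists_compl_in (U1 U : Submodule K A) (h : U1 ≤ U) : ∃ C : Submodule K A, U1 ⊔ C = U ∧
    Module.finrank K U1 + Module.finrank K C = Module.finrank K U := by
  obtain ⟨C, hC⟩ := Submodule.exists_isCompl U1
  have h1 : U1 ⊔ C ⊓ U = U := by
    rw [← sup_inf_assoc_of_le C h, hC.sup_eq_top, top_inf_eq]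
  refine ⟨C ⊓ U, h1, ?_⟩
  have h2 := Submodule.finrank_sup_add_finrank_inf_eq U1 (C ⊓ U)
  rw [h1, ← inf_assoc, hC.inf_eq_bot, bot_inf_eq, finrank_bot] at h2
  omega

lemma finrank_mr_le (P : A) (U : Submodule K A) : Module.finrank K (mr P U) ≤ Module.finrank K U :=
  Submodule.finrank_map_le _ _

lemma mr_sup (P : A) (U W : Submodule K A) : mr P (U ⊔ W) = mr P U ⊔ mr P W := Submodule.map_sup _ _ _

lemma drop_lem (P : A) (U1 U Y : Submodule K A) (h : U1 ≤ U) (hY : mr P U1 ≤ Y) :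
    Module.finrank K ↥(Y ⊔ mr P U) + Module.finrank K U1 ≤ Module.finrank K U + Module.finrank K Y := by
  obtain ⟨C, h1, h2⟩ := exists_compl_in U1 U h
  have h3 : Y ⊔ mr P U ≤ Y ⊔ mr P C := by
    rw [← h1, mr_sup]
    exact sup_le le_sup_left (sup_le (hY.trans le_sup_left) le_sup_right)
  have h4 := Submodule.finrank_mono h3
  have h5 := Submodule.finrank_add_le_finrank_add_finrank Y (mr P C)
  have h6 := finrank_mr_le P C
  omega

lemma mr_le_mul (V U : Submodule K A) {P : A} (hP : P ∈ V) : mr P U ≤ V * U := by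
  intro z hz
  obtain ⟨u, hu, rfl⟩ := mem_mr.1 hz
  exact Submodule.mul_mem_mul hP hu

lemma step_lem (V Y0 Y1 : Submodule K A) (m : ℕ) (P : A) (hP : P ∈ V) (hY : V * Y0 ≤ Y1)
    (hY1 : Y1 ≤ V ^ (m + 2)) (h : Y0 ⊔ mr P (V ^ m) = V ^ (m + 1)) :
    Module.finrank K ↥(V ^ (m + 2)) + Module.finrank K Y0 ≤ Module.finrank K ↥(V ^ (m + 1)) + Module.finrank K Y1 := by
  have h1 : V ^ (m + 2) ≤ Y1 ⊔ mr P (V ^ (m + 1)) := by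
    rw [pow_succ' V (m + 1), ← h, Submodule.mul_sup]
    rw [h]
    exact sup_le (hY.trans le_sup_left) (V_mul_mr.trans le_sup_right)
  have h2 := drop_lem P Y0 (V ^ (m + 1)) Y1 (by rw [← h]; exact le_sup_left) ((mr_le_mul V Y0 hP).trans hY)
  have h3 := Submodule.finrank_mono h1
  omega

lemma dstep (V Y0 : Submodule K A) (m : ℕ) (hY0 : Y0 ≤ V ^ (m + 1))
    (h : Module.finrank K ↥(V ^ (m + 1)) ≤ Module.finrank K Y0 + 1) :
    ∃ P ∈ V, Y0 ⊔ mr P (V ^ m) = V ^ (m + 1) := by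
  by_cases hle : V ^ (m + 1) ≤ Y0
  · refine ⟨0, V.zero_mem, le_antisymm (sup_le hY0 (mr_le V.zero_mem)) (hle.trans le_sup_left)⟩
  · rw [pow_succ', Submodule.mul_le] at hle
    push Not at hle
    obtain ⟨P, hP, u, hu, hPu⟩ := hle
    refine ⟨P, hP, Submodule.eq_of_le_of_finrank_le (sup_le hY0 (mr_le hP)) ?_⟩
    have : Y0 < Y0 ⊔ mr P (V ^ m) := by
      refine lt_of_le_of_ne le_sup_left fun he => hPu ?_
      rw [he]
      exact Submodule.mem_sup_right (mem_mr.2 ⟨u, hu, rfl⟩)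
    have := Submodule.finrank_lt_finrank_of_lt this
    omega

/-- monotonicity once `c_i ≤ i` -/
lemma mono_step [CharZero K] (V : Submodule K A) (L : A) (hL : L ∈ V) (m : ℕ)
    (h : Module.finrank K ↥(V ^ (m + 1)) ≤ Module.finrank K (mr L (V ^ m)) + (m + 1)) :
    Module.finrank K ↥(V ^ (m + 2)) + Module.finrank K (mr L (V ^ m)) ≤
      Module.finrank K ↥(V ^ (m + 1)) + Module.finrank K (mr L (V ^ (m + 1))) := by
  by_cases hh : ∀ P ∈ V, mr L (V ^ m) ⊔ mr P (V ^ m) ≠ V ^ (m + 1)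
  · have := lemA V _ m (mr_le hL) hh
    omega
  · push Not at hh
    obtain ⟨P, hP, hPe⟩ := hh
    exact step_lem V _ _ m P hP V_mul_mr (mr_le hL) hPe

lemma exists_M [CharZero K] (V : Submodule K A) (L : A) (hL : L ∈ V)
    (h : Module.finrank K ↥(V ^ 2) = Module.finrank K (mr L (V ^ 1)) + 3) :
    ∃ M ∈ V, Module.finrank K ↥(V ^ 2) ≤ Module.finrank K ↥(mr L (V ^ 1) ⊔ mr M (V ^ 1)) + 1 := by
  by_contra! hcon
  set Y := mr L (V ^ 1) with hYd
  obtain ⟨p, hp, hpY⟩ : ∃ p ∈ V, p ^ 2 ∉ Y := by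
    by_contra! hh
    have := Submodule.finrank_mono (pow_span V Y 2 hh)
    omega
  -- adding one vector
  have add1 : ∀ (Z : Submodule K A) (z : A), z ∉ Z → Module.finrank K ↥(Z ⊔ K ∙ z) = Module.finrank K Z + 1 := by
    intro Z z hz
    have h1 := Submodule.finrank_add_le_finrank_add_finrank Z (K ∙ z)
    have h2 : Module.finrank K (K ∙ z) ≤ 1 := by
      have := finrank_span_finset_le_card (R := K) ({z} : Finset A)
      rw [Finset.coe_singleton, Finset.card_singleton] at this
      exact this
    have h3 : Z < Z ⊔ K ∙ z := by
      refine lt_of_le_of_ne le_sup_left fun he => hz ?_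
      rw [he]
      exact Submodule.mem_sup_right (Submodule.mem_span_singleton_self z)
    have := Submodule.finrank_lt_finrank_of_lt h3
    omega
  have hp1 := add1 _ _ hpY
  obtain ⟨q, hq, hqY⟩ : ∃ q ∈ V, q ^ 2 ∉ Y ⊔ K ∙ p ^ 2 := by
    by_contra! hh
    have := Submodule.finrank_mono (pow_span V _ 2 hh)
    omega
  have hpq2 := add1 _ _ hqY
  have hqY' : q ^ 2 ∉ Y := fun hh => hqY (Submodule.mem_sup_left hh)
  have hq1 := add1 _ _ hqY'
  have sq : ∀ r ∈ V, r ^ 2 ∉ Y → ∀ s ∈ V, r * s ∈ Y ⊔ K ∙ r ^ 2 := by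
    intro r hr hrY s hs
    have h1 : Y ⊔ K ∙ r ^ 2 ≤ Y ⊔ mr r (V ^ 1) := by
      refine sup_le le_sup_left ?_
      rw [Submodule.span_singleton_le_iff_mem]
      exact Submodule.mem_sup_right (mem_mr.2 ⟨r, by simpa using hr, by ring⟩)
    have h2 := hcon r hr
    have h3 : Y ⊔ K ∙ r ^ 2 = Y ⊔ mr r (V ^ 1) := by
      refine Submodule.eq_of_le_of_finrank_le h1 ?_
      rw [add1 _ _ hrY]; omega
    rw [h3]
    exact Submodule.mem_sup_right (mem_mr.2 ⟨s, by simpa using hs, rfl⟩)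
  have hpq : p * q ∈ Y := by
    obtain ⟨a, ha, b, hb, hab⟩ := Submodule.mem_sup.1 (sq p hp hpY q hq)
    obtain ⟨a', ha', b', hb', hab'⟩ := Submodule.mem_sup.1 (sq q hq hqY' p hp)
    obtain ⟨β, rfl⟩ := Submodule.mem_span_singleton.1 hb'
    by_cases hβ : β = 0
    · subst hβ
      rw [mul_comm, ← hab']; simpa using ha'
    · exfalso
      apply hqY
      have h1 : β • q ^ 2 = a - a' + b := by
        rw [show β • q ^ 2 = q * p - a' from by rw [← hab']; ring, mul_comm q p, ← hab]; ring
      have h2 : β • q ^ 2 ∈ Y ⊔ K ∙ p ^ 2 := by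
        rw [h1]
        exact Submodule.add_mem _ (Submodule.mem_sup_left (Y.sub_mem ha ha')) (Submodule.mem_sup_right hb)
      have := Submodule.smul_mem _ β⁻¹ h2
      rwa [smul_smul, inv_mul_cancel₀ hβ, one_smul] at this
  have h1 := hcon (p + q) (V.add_mem hp hq)
  have h2 : (Y ⊔ K ∙ p ^ 2) ⊔ K ∙ q ^ 2 ≤ Y ⊔ mr (p + q) (V ^ 1) := by
    refine sup_le (sup_le le_sup_left ?_) ?_
    · rw [Submodule.span_singleton_le_iff_mem]
      have : p ^ 2 = -(p * q) + (p + q) * p := by ring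
      rw [this]
      exact Submodule.add_mem _ (Submodule.mem_sup_left (Y.neg_mem hpq))
        (Submodule.mem_sup_right (mem_mr.2 ⟨p, by simpa using hp, rfl⟩))
    · rw [Submodule.span_singleton_le_iff_mem]
      have : q ^ 2 = -(p * q) + (p + q) * q := by ring
      rw [this]
      exact Submodule.add_mem _ (Submodule.mem_sup_left (Y.neg_mem hpq))
        (Submodule.mem_sup_right (mem_mr.2 ⟨q, by simpa using hq, rfl⟩))
  have h3 := Submodule.finrank_mono h2
  omega

lemma growth [CharZero K] (V : Submodule K A) (L : A) (hL : L ∈ V)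
    (h : Module.finrank K ↥(V ^ 2) = Module.finrank K (mr L (V ^ 1)) + 3) :
    Module.finrank K ↥(V ^ 3) ≤ Module.finrank K (mr L (V ^ 2)) + 4 ∧
    Module.finrank K ↥(V ^ 4) + Module.finrank K (mr L (V ^ 2)) ≤
      Module.finrank K (mr L (V ^ 3)) + Module.finrank K ↥(V ^ 3) + 1 := by
  obtain ⟨M, hM, hd⟩ := exists_M V L hL h
  have hle : ∀ m, mr L (V ^ m) ⊔ mr M (V ^ m) ≤ V ^ (m + 1) := fun m => sup_le (mr_le hL) (mr_le hM)
  have hmul : ∀ m, V * (mr L (V ^ m) ⊔ mr M (V ^ m)) ≤ mr L (V ^ (m + 1)) ⊔ mr M (V ^ (m + 1)) := by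
    intro m
    rw [Submodule.mul_sup]
    exact sup_le_sup V_mul_mr V_mul_mr
  have dd : ∀ m, Module.finrank K ↥(V ^ (m + 1)) ≤ Module.finrank K ↥(mr L (V ^ m) ⊔ mr M (V ^ m)) + 1 →
      Module.finrank K ↥(V ^ (m + 2)) ≤ Module.finrank K ↥(mr L (V ^ (m + 1)) ⊔ mr M (V ^ (m + 1))) + 1 := by
    intro m hm
    obtain ⟨P, hP, hPe⟩ := dstep V _ m (hle m) hm
    have := step_lem V _ _ m P hP (hmul m) (hle (m + 1)) hPe
    omega
  have h2 : Module.finrank K ↥(V ^ 3) ≤ Module.finrank K ↥(mr L (V ^ 2) ⊔ mr M (V ^ 2)) + 1 := dd 1 hd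
  have h3 : Module.finrank K ↥(V ^ 4) ≤ Module.finrank K ↥(mr L (V ^ 3) ⊔ mr M (V ^ 3)) + 1 := dd 2 h2
  have cc : ∀ m, Module.finrank K ↥(mr L (V ^ (m + 1)) ⊔ mr M (V ^ (m + 1))) + Module.finrank K ↥(mr L (V ^ m)) ≤
      Module.finrank K ↥(V ^ (m + 1)) + Module.finrank K ↥(mr L (V ^ (m + 1))) := fun m =>
    drop_lem M _ _ _ (mr_le hL) ((mr_le_mul V _ hM).trans V_mul_mr)
  have c2 : Module.finrank K ↥(mr L (V ^ 2) ⊔ mr M (V ^ 2)) + Module.finrank K ↥(mr L (V ^ 1)) ≤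
      Module.finrank K ↥(V ^ 2) + Module.finrank K ↥(mr L (V ^ 2)) := cc 1
  have c3 : Module.finrank K ↥(mr L (V ^ 3) ⊔ mr M (V ^ 3)) + Module.finrank K ↥(mr L (V ^ 2)) ≤
      Module.finrank K ↥(V ^ 3) + Module.finrank K ↥(mr L (V ^ 3)) := cc 2
  constructor <;> omega

lemma exists_inj [CharZero K] (V : Submodule K A) (hV : Module.finrank K V = 4) 
    (hV2 : Module.finrank K ↥(V ^ 2) = 7) : ∃ L ∈ V, Module.finrank K (mr L V) = 4 := by
  by_contra hcon
  push Not at hcon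
  have hlt : ∀ L ∈ V, Module.finrank K (mr L V) ≤ 3 := by
    intro L hL
    have := hcon L hL
    have := finrank_mr_le L V
    omega
  have claim : ∀ L ∈ V, (∀ M ∈ V, Module.finrank K (mr M V) ≤ Module.finrank K (mr L V)) → L ^ 2 = 0 := by
    intro L hL hmax
    by_contra hL2
    have hL0 : L ≠ 0 := by rintro rfl; simp at hL2
    obtain ⟨v, hv, hv0, hLv⟩ : ∃ v ∈ V, v ≠ 0 ∧ L * v = 0 := by
      by_contra! hh
      have : Function.Injective ((LinearMap.mulLeft K L).domRestrict V) := by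
        rw [← LinearMap.ker_eq_bot, Submodule.eq_bot_iff]
        rintro ⟨v, hv⟩ h0
        by_contra hne
        exact hh v hv (fun h => hne (by simpa using h)) (by simpa using h0)
      have h1 := LinearMap.finrank_range_of_inj this
      rw [LinearMap.range_domRestrict] at h1
      have := hlt L hL
      rw [mr, h1] at this
      omega
    have hder : ∀ M ∈ V, M * v ∈ mr L V := by
      intro M hM
      by_contra hz
      have hfin := cofinA ⊥ V L M (M * v) (by rwa [bot_sup_eq]) (fun t => by
        rw [bot_sup_eq, bot_sup_eq]; exact hmax _ (V.add_mem hL (V.smul_mem _ hM)))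
      have : ({0}ᶜ : Set K) ⊆ {t : K | M * v ∈ ⊥ ⊔ mr (L + t • M) V} := by
        intro t ht
        rw [Set.mem_ofPred_eq, bot_sup_eq]
        refine mem_mr.2 ⟨t⁻¹ • v, V.smul_mem _ hv, ?_⟩
        have ht' : t ≠ 0 := ht
        rw [add_mul, mul_smul_comm, hLv, smul_zero, zero_add, smul_mul_smul_comm, mul_inv_cancel₀ ht', one_smul]
      exact (Set.finite_singleton (0:K)).infinite_compl (hfin.subset this)
    have hli : LinearIndependent K ![L, v] := by
      rw [LinearIndependent.pair_iff' hL0]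
      rintro a rfl
      have ha : a ≠ 0 := by rintro rfl; simp at hv0
      rw [mul_smul_comm, smul_eq_zero] at hLv
      rcases hLv with h | h
      · exact ha h
      · exact hL2 (by rw [pow_two]; exact h)
    have hZ : Module.finrank K (Submodule.span K (Set.range ![L, v])) = 2 := by
      rw [finrank_span_eq_card hli]; simp
    obtain ⟨C, hC1, hC2⟩ := exists_compl_in (Submodule.span K (Set.range ![L, v])) V (by
      rw [Submodule.span_le]
      rintro _ ⟨i, rfl⟩
      fin_cases i
      · exact hL
      · exact hv)
    have hC : Module.finrank K C = 2 := by omega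
    let b := Module.finBasisOfFinrankEq K C hC
    have hCs : C = Submodule.span K {(b 0 : A), (b 1 : A)} := by
      have := congrArg (Submodule.map C.subtype) b.span_eq
      rw [Submodule.map_span, Submodule.map_top, Submodule.range_subtype, ← Set.range_comp] at this
      refine this.symm.trans ?_
      congr 1
      ext x
      simp [Fin.exists_fin_two, eq_comm]
    have hCC : Module.finrank K ↥(C * C) ≤ 3 := by
      classical
      have : C * C ≤ Submodule.span K (({(b 0 : A) * b 0, (b 0 : A) * b 1, (b 1 : A) * b 1} : Finset A) : Set A) := by
        conv_lhs => rw [hCs, Submodule.span_mul_span]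
        rw [Submodule.span_le]
        rintro _ ⟨x, hx, y, hy, rfl⟩
        apply Submodule.subset_span
        simp only [Set.mem_insert_iff, Set.mem_singleton_iff] at hx hy
        rcases hx with rfl | rfl <;> rcases hy with rfl | rfl <;> simp [mul_comm]
      exact (Submodule.finrank_mono this).trans ((finrank_span_finset_le_card _).trans Finset.card_le_three)
    have hVV : V ^ 2 ≤ mr L V ⊔ C * C := by
      have hZV : ∀ z ∈ Submodule.span K (Set.range ![L, v]), ∀ w ∈ V, z * w ∈ mr L V := by
        intro z hz w hw
        have : Submodule.span K (Set.range ![L, v]) ≤ (mr L V).comap (LinearMap.mulRight K w) := by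
          rw [Submodule.span_le]
          rintro _ ⟨i, rfl⟩
          fin_cases i
          · exact mem_mr.2 ⟨w, hw, rfl⟩
          · have := hder w hw
            rw [mul_comm] at this
            exact this
        exact this hz
      rw [pow_two, Submodule.mul_le]
      intro x hx y hy
      have hx' := hx
      have hy' := hy
      rw [← hC1] at hx' hy'
      obtain ⟨z, hz, c, hc, rfl⟩ := Submodule.mem_sup.1 hx'
      obtain ⟨z', hz', c', hc', rfl⟩ := Submodule.mem_sup.1 hy'
      have hcV : c ∈ V := by rw [← hC1]; exact Submodule.mem_sup_right hc
      have : (z + c) * (z' + c') = (z * (z' + c') + z' * c) + c * c' := by ring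
      rw [this]
      exact Submodule.add_mem _ (Submodule.mem_sup_left (Submodule.add_mem _ (hZV _ hz _ hy) (hZV _ hz' _ hcV)))
        (Submodule.mem_sup_right (Submodule.mul_mem_mul hc hc'))
    have h1 := Submodule.finrank_mono hVV
    have h2 := Submodule.finrank_add_le_finrank_add_finrank (mr L V) (C * C)
    have h3 := hlt L hL
    omega
  obtain ⟨L, hL, hmax⟩ := exists_max (fun L => L ∈ V) (fun L => Module.finrank K (mr L V))
    (Module.finrank K A) (fun a => Submodule.finrank_le _) ⟨0, V.zero_mem⟩
  have : V ^ 2 ≤ ⊥ := by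
    apply pow_span
    intro M hM
    have hfin := cofinB ⊥ V L M (Module.finrank K (mr L V)) (by rw [bot_sup_eq])
    have := curve_mem (⊥ : Submodule K A) 3 (fun k => if k = 0 then L ^ 2 else if k = 1 then 2 * (L * M) else M ^ 2) 
      _ hfin.infinite_compl (by
        intro t ht
        have ht' : ¬ Module.finrank K ↥(⊥ ⊔ mr (L + t • M) V) < Module.finrank K (mr L V) := ht
        rw [bot_sup_eq] at ht'
        have := claim (L + t • M) (V.add_mem hL (V.smul_mem _ hM)) (fun M hM => (hmax M hM).trans (by omega))
        rw [Submodule.mem_bot, ← this]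
        simp [Finset.sum_range_succ, Algebra.smul_def]
        ring) 2 (by omega)
    simpa using this
  have h7 := Submodule.finrank_mono this
  rw [hV2, finrank_bot] at h7
  omega

lemma algebra_main [CharZero K] (V : Submodule K A) (hV : Module.finrank K V = 4) 
    (hV2 : Module.finrank K ↥(V ^ 2) = 7) : ∃ L ∈ V, Module.finrank K (mr L (V ^ 1)) = 4 ∧
    Module.finrank K ↥(V ^ 3) ≤ Module.finrank K (mr L (V ^ 2)) + 4 ∧
    Module.finrank K ↥(V ^ 4) + Module.finrank K (mr L (V ^ 2)) ≤
      Module.finrank K (mr L (V ^ 3)) + Module.finrank K ↥(V ^ 3) + 1 ∧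
    (Module.finrank K (mr L (V ^ 3)) + 5 ≤ Module.finrank K ↥(V ^ 4) → 15 ≤ Module.finrank K ↥(V ^ 4)) ∧
    ∀ m, Module.finrank K ↥(V ^ (m + 1)) ≤ Module.finrank K (mr L (V ^ m)) + (m + 1) →
    Module.finrank K ↥(V ^ (m + 2)) + Module.finrank K (mr L (V ^ m)) ≤
      Module.finrank K ↥(V ^ (m + 1)) + Module.finrank K (mr L (V ^ (m + 1))) := by
  obtain ⟨L0, hL0, hr0⟩ := exists_inj V hV hV2
  obtain ⟨L, hL, hr, hgen⟩ : ∃ L ∈ V, Module.finrank K (mr L V) = 4 ∧ 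
      ((∃ P ∈ V, ∃ M ∈ V, mr P (V ^ 3) ⊔ mr M (V ^ 3) = V ^ 4) → ∃ M ∈ V, mr L (V ^ 3) ⊔ mr M (V ^ 3) = V ^ 4) := by
    by_cases hh : ∃ P ∈ V, ∃ M ∈ V, mr P (V ^ 3) ⊔ mr M (V ^ 3) = V ^ 4
    · obtain ⟨P, hP, M, hM, hPM⟩ := hh
      have f1 := cofinB ⊥ V L0 (P - L0) 4 (by rw [bot_sup_eq, hr0])
      have f2 := cofinB (mr M (V ^ 3)) (V ^ 3) P (L0 - P) (Module.finrank K ↥(V ^ 4)) (by rw [sup_comm, hPM])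
      have f3 := f2.image (fun t => 1 - t)
      obtain ⟨t, ht⟩ := (f1.union f3).infinite_compl.nonempty
      have ht1 : ¬ Module.finrank K ↥(⊥ ⊔ mr (L0 + t • (P - L0)) V) < 4 := fun h => ht (Or.inl h)
      have ht2 : ¬ Module.finrank K ↥(mr M (V ^ 3) ⊔ mr (P + (1 - t) • (L0 - P)) (V ^ 3)) < Module.finrank K ↥(V ^ 4) :=
        fun h => ht (Or.inr ⟨1 - t, h, by ring⟩)
      have e : P + (1 - t) • (L0 - P) = L0 + t • (P - L0) := by
        simp only [Algebra.smul_def, map_sub, map_one]; ring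
      rw [e] at ht2
      have hLV : L0 + t • (P - L0) ∈ V := V.add_mem hL0 (V.smul_mem _ (V.sub_mem hP hL0))
      refine ⟨_, hLV, ?_, fun _ => ⟨M, hM, ?_⟩⟩
      · rw [bot_sup_eq] at ht1
        have := finrank_mr_le (L0 + t • (P - L0)) V
        omega
      · apply Submodule.eq_of_le_of_finrank_le (sup_le (mr_le hLV) (mr_le hM))
        change Module.finrank K ↥(V ^ 4) ≤ _
        rw [sup_comm]
        omega
    · exact ⟨L0, hL0, hr0, fun h => absurd h hh⟩
  have hr1 : Module.finrank K (mr L (V ^ 1)) = 4 := by rw [pow_one]; exact hr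
  obtain ⟨g1, g2⟩ := growth V L hL (by omega)
  refine ⟨L, hL, hr1, g1, g2, fun h5 => ?_, fun m => mono_step V L hL m⟩
  apply lemG
  intro P hP M hM hPM
  obtain ⟨M', hM', he⟩ := hgen ⟨P, hP, M, hM, hPM⟩
  have := drop_lem M' (mr L (V ^ 2)) (V ^ 3) (mr L (V ^ 3)) (mr_le hL) ((mr_le_mul V _ hM').trans V_mul_mr)
  rw [he] at this
  omega

end alg2

section gor
variable {K A : Type*} [Field K] [CommRing A] [Algebra K A] [FiniteDimensional K A]

/-- the bilinear form `(a, b) ↦ ψ (e a b)` on `U × W` -/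
def bform (ψ : A →ₗ[K] K) (e : A) (U W : Submodule K A) : U →ₗ[K] W →ₗ[K] K :=
  LinearMap.mk₂ K (fun a b => ψ (e * a * b))
    (fun a a' b => by simp [mul_add, add_mul])
    (fun c a b => by simp)
    (fun a b b' => by simp [mul_add])
    (fun c a b => by simp)

lemma bform_rank (ψ : A →ₗ[K] K) (e : A) (U W : Submodule K A)
    (h : ∀ a ∈ U, (∀ b ∈ W, ψ (e * a * b) = 0) → e * a = 0) :
    Module.finrank K (LinearMap.range (bform ψ e U W)) = Module.finrank K (mr e U) := by
  have hk : LinearMap.ker (bform ψ e U W) = LinearMap.ker ((LinearMap.mulLeft K e).domRestrict U) := by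
    ext ⟨a, ha⟩
    rw [LinearMap.mem_ker, LinearMap.mem_ker]
    constructor
    · intro h0
      refine h a ha fun b hb => ?_
      exact LinearMap.congr_fun h0 (⟨b, hb⟩ : W)
    · intro h0
      have h0' : e * a = 0 := h0
      ext ⟨b, hb⟩
      change ψ (e * a * b) = 0
      rw [h0', zero_mul, map_zero]
  have h1 := LinearMap.finrank_range_add_finrank_ker (bform ψ e U W)
  have h2 := LinearMap.finrank_range_add_finrank_ker ((LinearMap.mulLeft K e).domRestrict U)
  rw [hk] at h1
  rw [LinearMap.range_domRestrict] at h2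
  unfold mr
  omega

lemma gor_sym (V : Submodule K A) (j : ℕ) (h1 : Module.finrank K ↥(V ^ j) = 1)
    (hnd : ∀ i i', i + i' = j → ∀ a ∈ V ^ i, a ≠ 0 → ∃ b ∈ V ^ i', a * b ≠ 0)
    (d p q : ℕ) (hj : d + p + q = j) (e : A) (he : e ∈ V ^ d) :
    Module.finrank K (mr e (V ^ p)) = Module.finrank K (mr e (V ^ q)) := by
  obtain ⟨f⟩ : Nonempty (↥(V ^ j) ≃ₗ[K] K) := by
    refine ⟨LinearEquiv.ofFinrankEq _ _ ?_⟩
    rw [h1, Module.finrank_self]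
  obtain ⟨ψ, hψ⟩ := LinearMap.exists_extend f.toLinearMap
  have hψ0 : ∀ a ∈ V ^ j, ψ a = 0 → a = 0 := by
    intro a ha h0
    have h2 := LinearMap.congr_fun hψ ⟨a, ha⟩
    have h3 : ψ a = f ⟨a, ha⟩ := h2
    rw [h0] at h3
    have h4 := (LinearEquiv.map_eq_zero_iff f).1 h3.symm
    simpa using h4
  have key : ∀ p q, d + p + q = j → ∀ a ∈ V ^ p, (∀ b ∈ V ^ q, ψ (e * a * b) = 0) → e * a = 0 := by
    intro p q hpq a ha hb
    by_contra hne
    have hea : e * a ∈ V ^ (d + p) := by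
      rw [pow_add]; exact Submodule.mul_mem_mul he ha
    obtain ⟨b, hbm, hb0⟩ := hnd (d + p) q hpq _ hea hne
    refine hb0 (hψ0 _ ?_ (hb b hbm))
    rw [← hpq, pow_add _ (d + p) q]
    exact Submodule.mul_mem_mul hea hbm
  rw [← bform_rank ψ e _ _ (key p q hj), ← bform_rank ψ e _ _ (key q p (by omega)), finrank_flip]
  have hflip : (bform ψ e (V ^ p) (V ^ q)).flip = bform ψ e (V ^ q) (V ^ p) := by
    refine LinearMap.ext fun a => LinearMap.ext fun b => ?_
    change ψ (e * b * a) = ψ (e * a * b)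
    rw [mul_right_comm]
  rw [hflip]

lemma mul_mem_pow (V : Submodule K A) {v a : A} {n : ℕ} (hv : v ∈ V) (ha : a ∈ V ^ n) :
    v * a ∈ V ^ (n + 1) := by
  rw [pow_succ']; exact Submodule.mul_mem_mul hv ha

lemma one_mem_pow (V : Submodule K A) : (1 : A) ∈ V ^ 0 := by
  rw [pow_zero]; exact Submodule.one_le.1 le_rfl

lemma gor_nd (V : Submodule K A) (j : ℕ) (hS : ∀ a : A, (∀ v ∈ V, v * a = 0) → a ∈ V ^ j)
    (hdis : ∀ i, i < j → ∀ a ∈ V ^ i, a ∈ V ^ j → a = 0) :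
    ∀ i' i, i + i' = j → ∀ a ∈ V ^ i, a ≠ 0 → ∃ b ∈ V ^ i', a * b ≠ 0 := by
  intro n
  induction n with
  | zero =>
    intro i _ a _ h0
    exact ⟨1, by rw [pow_zero]; exact Submodule.one_le.1 le_rfl, by simpa using h0⟩
  | succ n ih =>
    intro i hi a ha h0
    obtain ⟨v, hv, hva⟩ : ∃ v ∈ V, v * a ≠ 0 := by
      by_contra! hh
      exact h0 (hdis i (by omega) a ha (hS a hh))
    obtain ⟨b, hb, hne⟩ := ih (i + 1) (by omega) (v * a) (by rw [pow_succ']; exact Submodule.mul_mem_mul hv ha) hva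
    refine ⟨v * b, by rw [pow_succ']; exact Submodule.mul_mem_mul hv hb, ?_⟩
    intro h
    apply hne
    rw [← h]; ring

end gor

lemma numeric (j : ℕ) (hj : 6 ≤ j) (h r : ℕ → ℕ) (h2 : h 2 = 7)
    (hsym : ∀ p q, p + q = j → h p = h q) (rsym : ∀ p q, 1 + p + q = j → r p = r q)
    (rle : ∀ p, r p ≤ h p) (rle' : ∀ p, r p ≤ h (p + 1))
    (g3 : h 3 ≤ r 2 + 4) (g4 : h 4 + r 2 ≤ r 3 + h 3 + 1) (g5 : r 3 + 5 ≤ h 4 → 15 ≤ h 4)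
    (mono : ∀ m, h (m + 1) ≤ r m + (m + 1) → h (m + 2) + r m ≤ h (m + 1) + r (m + 1)) :
    (7 ≤ h 3 ∧ h 3 ≤ 11) ∧ (7 ≤ j → h 3 ≤ h 4 ∧ h 4 ≤ bmax (h 3)) := by
  have s2 := hsym (j - 2) 2 (by omega)
  have s3 := hsym (j - 3) 3 (by omega)
  have t2 := rsym (j - 3) 2 (by omega)
  have t3 := rsym (j - 4) 3 (by omega)
  have r2 := rle 2
  have r3 := rle 3
  have r2' : r 2 ≤ h 3 := rle' 2
  have r3' : r 3 ≤ h 4 := rle' 3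
  have m2 : h 3 ≤ r 2 + 3 → h 4 + r 2 ≤ h 3 + r 3 := mono 2
  have mj := mono (j - 4)
  rw [show j - 4 + 1 = j - 3 by omega, show j - 4 + 2 = j - 2 by omega, s2, s3, t3, t2] at mj
  by_cases h4 : h 4 ≤ r 3 + 4
  · have anti : ∀ n, h (n + 4) ≤ r (n + 3) + 4 ∧ h (n + 4) + r 3 ≤ r (n + 3) + h 4 := by
      intro n
      induction n with
      | zero => exact ⟨h4, by simp [add_comm]⟩
      | succ n ih =>
        have := mono (n + 3) (by have := ih.1; rw [show n + 3 + 1 = n + 4 by omega]; omega)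
        rw [show n + 3 + 1 = n + 1 + 3 by omega, show n + 3 + 2 = n + 1 + 4 by omega,
          show n + 1 + 3 = n + 4 by omega] at this
        rw [show n + 1 + 3 = n + 4 by omega]
        omega
    have a2 := anti (j - 6)
    rw [show j - 6 + 4 = j - 2 by omega, show j - 6 + 3 = j - 3 by omega, s2, t2] at a2
    refine ⟨by omega, fun hj7 => ?_⟩
    have a3 := anti (j - 7)
    rw [show j - 7 + 4 = j - 3 by omega, show j - 7 + 3 = j - 4 by omega, s3, t3] at a3
    unfold bmax
    split_ifs <;> omega
  · have h15 := g5 (by omega)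
    have hj7 : 7 ≤ j := by
      by_contra hlt
      have := hsym 4 2 (by omega)
      omega
    unfold bmax
    split_ifs <;> omega

section conc
variable {K : Type*} [Field K]

/-- image of linear forms in the quotient -/
def lin1 (I : Ideal (MvPolynomial (Fin 4) K)) : Submodule K (MvPolynomial (Fin 4) K ⧸ I) :=
  (homogeneousSubmodule (Fin 4) K 1).map (Ideal.Quotient.mkₐ K I).toLinearMap

lemma lin1_pow (I : Ideal (MvPolynomial (Fin 4) K)) (i : ℕ) :
    (homogeneousSubmodule (Fin 4) K i).map (Ideal.Quotient.mkₐ K I).toLinearMap = lin1 I ^ i := by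
  rw [lin1, ← Submodule.map_pow, homogeneousSubmodule_one_pow]

lemma hilb_eq (I : Ideal (MvPolynomial (Fin 4) K)) (i : ℕ) :
    hilb 4 K I i = Module.finrank K ↥(lin1 I ^ i) := by
  rw [hilb, lin1_pow]

lemma lin1_X (I : Ideal (MvPolynomial (Fin 4) K)) (k : Fin 4) : Ideal.Quotient.mk I (X k) ∈ lin1 I :=
  Submodule.mem_map.2 ⟨X k, isHomogeneous_X K k, rfl⟩

lemma lin1_disj (I : Ideal (MvPolynomial (Fin 4) K)) (hI : IdealHomog I) (i j : ℕ) (hij : i ≠ j)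
    (a : MvPolynomial (Fin 4) K ⧸ I) (h1 : a ∈ lin1 I ^ i) (h2 : a ∈ lin1 I ^ j) : a = 0 := by
  rw [← lin1_pow] at h1 h2
  obtain ⟨f, hf, rfl⟩ := Submodule.mem_map.1 h1
  obtain ⟨g, hg, hfg⟩ := Submodule.mem_map.1 h2
  have hfg' : Ideal.Quotient.mk I f = Ideal.Quotient.mk I g := hfg.symm
  rw [Ideal.Quotient.eq] at hfg'
  have := hI _ hfg' i
  rw [map_sub, homogeneousComponent_of_mem hf, homogeneousComponent_of_mem hg, if_pos rfl, if_neg hij, sub_zero] at this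
  exact Ideal.Quotient.eq_zero_iff_mem.2 this

end conc

lemma gor_main {K : Type*} [Field K] [CharZero K]
    (j : ℕ) (hj : 6 ≤ j) (h : ℕ → ℕ) (h1 : h 1 = 4) (h2 : h 2 = 7)
    (I : Ideal (MvPolynomial (Fin 4) K)) (hA : IsAG 4 K I j) (hh : ∀ i, hilb 4 K I i = h i) :
    (7 ≤ h 3 ∧ h 3 ≤ 11) ∧ (7 ≤ j → h 3 ≤ h 4 ∧ h 4 ≤ bmax (h 3)) := by
  obtain ⟨hom, hfd, hsoc, hjn, hgt⟩ := hA
  have hV : ∀ i, Module.finrank K ↥(lin1 I ^ i) = h i := fun i => by rw [← hilb_eq, hh]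
  have hle : lin1 I ^ j ≤ socleSub 4 K I := by
    intro a ha
    rw [socleSub, Submodule.mem_iInf]
    intro k
    rw [LinearMap.mem_ker, LinearMap.mulLeft_apply]
    have hm : Ideal.Quotient.mk I (X k) * a ∈ lin1 I ^ (j + 1) :=
      mul_mem_pow (lin1 I) (lin1_X I k) ha
    have h0 := hgt (j + 1) (by omega)
    rw [hilb_eq, Submodule.finrank_eq_zero] at h0
    rw [h0] at hm
    simpa using hm
  rw [hilb_eq] at hjn
  have heq : lin1 I ^ j = socleSub 4 K I := Submodule.eq_of_le_of_finrank_le hle (by omega)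
  have hone : Module.finrank K ↥(lin1 I ^ j) = 1 := by rw [heq]; exact hsoc
  have hnd := gor_nd (lin1 I) j (by
    intro a ha
    rw [heq, socleSub, Submodule.mem_iInf]
    intro k
    exact ha _ (lin1_X I k)) (fun i hi a => lin1_disj I hom i j (by omega) a)
  have hsymm := gor_sym (lin1 I) j hone (fun i i' => hnd i' i)
  obtain ⟨L, hL, hL1, g3, g4, g5, mono⟩ := algebra_main (lin1 I) (by
    have := hh 1
    rw [h1] at this
    exact this) (by rw [hV, h2])
  simp only [hV] at g3 g4 g5 mono
  refine numeric j hj h (fun m => Module.finrank K (mr L (lin1 I ^ m))) h2 ?_ ?_ ?_ ?_ g3 g4 g5 mono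
  · intro p q hpq
    have := hsymm 0 p q (by omega) 1 (one_mem_pow _)
    have e : ∀ U : Submodule K (MvPolynomial (Fin 4) K ⧸ I), mr 1 U = U := by
      intro U; ext z; rw [mem_mr]; simp
    rwa [e, e, hV, hV] at this
  · intro p q hpq
    exact hsymm 1 p q hpq L (by rwa [pow_one])
  · intro p
    rw [← hV]; exact finrank_mr_le _ _
  · intro p
    rw [← hV]; exact Submodule.finrank_mono (mr_le hL)

lemma osez (a b : ℕ) (ha : 7 ≤ a) (ha' : a ≤ 11) (hb : a ≤ b) (hb' : b ≤ bmax a) :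
    IsOSeqZ (fun i => if i = 0 then 1 else if i = 1 then 3 else if i = 2 then 3
        else if i = 3 then (a : ℤ) - 7 else if i = 4 then (b : ℤ) - (a : ℤ)
        else 0) 4 := by
  have e1 : macB 3 1 = 6 := by decide
  have e2 : macB 3 2 = 4 := by decide
  have f0 : macB 0 3 = 0 := by decide
  have f1 : macB 1 3 = 1 := by decide
  have f2 : macB 2 3 = 2 := by decide
  have f3 : macB 3 3 = 3 := by decide
  have f4 : macB 4 3 = 5 := by decide
  refine ⟨rfl, ?_, ?_⟩
  · intro i hi
    interval_cases i <;> simp <;> omega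
  · intro i hi hi'
    have hi4 : i ≤ 3 := by omega
    interval_cases i
    · simp [e1]
    · simp [e2]; omega
    · interval_cases a <;> simp [bmax] at hb' <;> simp [f0, f1, f2, f3, f4] <;> omega

/-- Let `H = (1,4,7,h,b,...)` be a Gorenstein sequence of
socle degree `j ≥ 6`.  Then `7 ≤ h ≤ 11`; if `j ≥ 7` then `h ≤ b ≤ b_max(h)`,
and this bound is equivalent to `(1,3,3,h-7,b-h)` being an O-sequence. -/
theorem statement_14 {K : Type*} [Field K] [IsAlgClosed K] [CharZero K]
    (j : ℕ) (hj : 6 ≤ j) (h : ℕ → ℕ)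
    (h0 : h 0 = 1) (h1 : h 1 = 4) (h2 : h 2 = 7)
    (hGor : ∃ I : Ideal (MvPolynomial (Fin 4) K), IsAG 4 K I j ∧
      ∀ i, hilb 4 K I i = h i) :
    (7 ≤ h 3 ∧ h 3 ≤ 11) ∧
    (7 ≤ j → h 3 ≤ h 4 ∧ h 4 ≤ bmax (h 3)) ∧
    (7 ≤ j → ((h 3 ≤ h 4 ∧ h 4 ≤ bmax (h 3)) ↔
      IsOSeqZ (fun i => if i = 0 then 1 else if i = 1 then 3 else if i = 2 then 3
        else if i = 3 then (h 3 : ℤ) - 7 else if i = 4 then (h 4 : ℤ) - (h 3 : ℤ)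
        else 0) 4)) := by
  obtain ⟨I, hA, hh⟩ := hGor
  obtain ⟨p1, p2⟩ := gor_main j hj h h1 h2 I hA hh
  refine ⟨p1, p2, fun hj7 => ⟨fun hb => osez (h 3) (h 4) p1.1 p1.2 hb.1 hb.2, fun _ => p2 hj7⟩⟩

end
end

section
/- For every pair of integers (h, b) with 7 ≤ h ≤ 11 and h ≤ b ≤ b_max(h), where b_max(7) = 7, b_max(8) = 9, b_max(9) = 11, b_max(10) = 13, b_max(11) = 16, there exists a graded Artinian Gorenstein quotient of R = K[w,x,y,z] of socle degree 8 whose Hilbert function is (1, 4, 7, h, b, h, 7, 4, 1). -/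
open MvPolynomial

noncomputable section

/-! ### Helper material -/

abbrev Pt := ℕ × ℕ × ℕ

def Pt.deg (s : Pt) : ℕ := s.1 + s.2.1 + s.2.2

section Helper

variable {K : Type*} [Field K]

theorem hc_mul_left {f : MvPolynomial (Fin 4) K} {i : ℕ}
    (hf : f ∈ homogeneousSubmodule (Fin 4) K i) (g : MvPolynomial (Fin 4) K) (n : ℕ) :
    homogeneousComponent n (f * g) =
      if i ≤ n then f * homogeneousComponent (n - i) g else 0 := by
  induction g using MvPolynomial.induction_on' with
  | monomial d a =>
    have hm : monomial d a ∈ homogeneousSubmodule (Fin 4) K d.degree :=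
      isHomogeneous_monomial a rfl
    have hfm : f * monomial d a ∈ homogeneousSubmodule (Fin 4) K (i + d.degree) :=
      IsHomogeneous.mul hf hm
    rw [homogeneousComponent_of_mem hfm, homogeneousComponent_of_mem hm]
    by_cases h1 : i ≤ n
    · by_cases h2 : n = i + d.degree
      · have : n - i = d.degree := by omega
        simp [h1, h2]
      · have : n - i ≠ d.degree := by omega
        simp [h1, h2, this]
    · have : n ≠ i + d.degree := by omega
      simp [h1, this]
  | add p q hp hq =>
    rw [mul_add, map_add, hp, hq]
    split_ifs <;> simp [mul_add]

/-- The point of affine 4-space attached to an exponent vector. -/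
def pt (K : Type*) [Field K] (p : Pt) : Fin 4 → K := ![(p.1 : K), (p.2.1 : K), (p.2.2 : K), 1]

/-- Evaluation at the points of `S`. -/
def ev (K : Type*) [Field K] (S : Finset Pt) :
    MvPolynomial (Fin 4) K →ₗ[K] ({x // x ∈ S} → K) :=
  LinearMap.pi fun p => (aeval (pt K p.1)).toLinearMap

theorem ev_apply (S : Finset Pt) (f : MvPolynomial (Fin 4) K) (p : {x // x ∈ S}) :
    ev K S f p = aeval (pt K p.1) f := rfl

theorem ev_mul (S : Finset Pt) (f g : MvPolynomial (Fin 4) K) :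
    ev K S (f * g) = ev K S f * ev K S g := by
  funext p
  simp [ev_apply]

def EE (K : Type*) [Field K] (S : Finset Pt) (i : ℕ) : Submodule K ({x // x ∈ S} → K) :=
  (homogeneousSubmodule (Fin 4) K i).map (ev K S)

/-- Newton basis functions. -/
def Nw (K : Type*) [Field K] (S : Finset Pt) (s : Pt) : {x // x ∈ S} → K := fun p =>
  (p.1.1.descFactorial s.1 : K) * (p.1.2.1.descFactorial s.2.1 : K)
    * (p.1.2.2.descFactorial s.2.2 : K)

theorem cast_desc_succ (n k : ℕ) :
    ((n.descFactorial (k + 1) : ℕ) : K) = ((n : K) - k) * (n.descFactorial k : K) := by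
  rw [Nat.descFactorial_succ]
  rcases le_or_gt k n with h | h
  · push_cast [Nat.cast_sub h]; ring
  · rw [Nat.descFactorial_of_lt h]; simp

def WW (K : Type*) [Field K] (S : Finset Pt) (i : ℕ) : Submodule K ({x // x ∈ S} → K) :=
  Submodule.span K (Nw K S '' {s | s.deg ≤ i})

theorem EE_mul_lin (S : Finset Pt) {i : ℕ} {v : {x // x ∈ S} → K} (hv : v ∈ EE K S i)
    (j : Fin 4) (c : K) :
    (fun p => (pt K p.1 j - c) * v p) ∈ EE K S (i + 1) := by
  obtain ⟨f, hf, rfl⟩ := hv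
  refine ⟨(X j - C c * X 3) * f, ?_, ?_⟩
  · have h1 : (X j - C c * X 3 : MvPolynomial (Fin 4) K) ∈ homogeneousSubmodule (Fin 4) K 1 := by
      refine Submodule.sub_mem _ (isHomogeneous_X K j) ?_
      rw [← smul_eq_C_mul]
      exact Submodule.smul_mem _ _ (isHomogeneous_X K 3)
    rw [add_comm i 1]
    exact IsHomogeneous.mul h1 hf
  · funext p
    simp [ev_apply, pt]

theorem EE_mul_one (S : Finset Pt) {i : ℕ} {v : {x // x ∈ S} → K} (hv : v ∈ EE K S i) :
    v ∈ EE K S (i + 1) := by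
  have := EE_mul_lin S hv 3 0
  simpa [pt] using this

theorem EE_mono (S : Finset Pt) {i j : ℕ} (h : i ≤ j) : EE K S i ≤ EE K S j := by
  induction j, h using Nat.le_induction with
  | base => exact le_rfl
  | succ j _ ih => exact ih.trans fun v hv => EE_mul_one S hv

theorem Nw_mem_EE (S : Finset Pt) (a b c : ℕ) : Nw K S (a, b, c) ∈ EE K S (a + b + c) := by
  induction c with
  | zero =>
    induction b with
    | zero =>
      induction a with
      | zero =>
        refine ⟨1, isHomogeneous_one _ _, ?_⟩
        funext p
        simp [ev_apply, Nw]
      | succ a ih =>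
        have := EE_mul_lin S ih 0 (a : K)
        convert this using 1
        funext p
        simp only [Nw, cast_desc_succ, pt]
        simp [mul_assoc]
    | succ b ih =>
      have := EE_mul_lin S ih 1 (b : K)
      convert this using 1
      · exact congrArg _ (by omega)
      funext p
      simp only [Nw, cast_desc_succ, pt]
      simp
      ring
  | succ c ih =>
    have := EE_mul_lin S ih 2 (c : K)
    convert this using 1
    · exact congrArg _ (by omega)
    funext p
    simp only [Nw, cast_desc_succ, pt]
    simp
    ring

theorem WW_le_EE (S : Finset Pt) (i : ℕ) : WW K S i ≤ EE K S i := by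
  refine Submodule.span_le.2 ?_
  rintro _ ⟨⟨a, b, c⟩, hs, rfl⟩
  exact EE_mono S hs (Nw_mem_EE S a b c)

theorem WW_mono (S : Finset Pt) {i j : ℕ} (h : i ≤ j) : WW K S i ≤ WW K S j :=
  Submodule.span_mono (Set.image_mono fun _ hs => le_trans hs h)

/-- Multiplication by the coordinate function. -/
def mulc (S : Finset Pt) (u : {x // x ∈ S} → K) : ({x // x ∈ S} → K) →ₗ[K] ({x // x ∈ S} → K) :=
  LinearMap.mulLeft K u

theorem WW_mul (S : Finset Pt) {i : ℕ} (u : {x // x ∈ S} → K)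
    (hu : ∀ s : Pt, ∃ t : Pt, ∃ c : K, t.deg = s.deg + 1 ∧
      u * Nw K S s = Nw K S t + c • Nw K S s)
    {v : {x // x ∈ S} → K} (hv : v ∈ WW K S i) : u * v ∈ WW K S (i + 1) := by
  have : WW K S i ≤ (WW K S (i + 1)).comap (mulc S u) := by
    refine Submodule.span_le.2 ?_
    rintro _ ⟨s, hs, rfl⟩
    obtain ⟨t, c, ht, h⟩ := hu s
    change u * Nw K S s ∈ WW K S (i + 1)
    have hs' : s.deg ≤ i := hs
    rw [h]
    refine Submodule.add_mem _ (Submodule.subset_span ⟨t, ?_, rfl⟩)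
      (Submodule.smul_mem _ _ (Submodule.subset_span ⟨s, ?_, rfl⟩))
    · change t.deg ≤ i + 1
      omega
    · change s.deg ≤ i + 1
      omega
  exact this hv

theorem mono_mem_WW (S : Finset Pt) (a b c : ℕ) :
    (fun p : {x // x ∈ S} => (p.1.1 : K) ^ a * (p.1.2.1 : K) ^ b * (p.1.2.2 : K) ^ c)
      ∈ WW K S (a + b + c) := by
  induction c with
  | zero =>
    induction b with
    | zero =>
      induction a with
      | zero =>
        refine Submodule.subset_span ⟨(0, 0, 0), by simp [Pt.deg], ?_⟩
        funext p
        simp [Nw]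
      | succ a ih =>
        have := WW_mul S (fun p => (p.1.1 : K)) (fun s => ⟨(s.1 + 1, s.2.1, s.2.2), (s.1 : K),
          by simp only [Pt.deg]; omega, by
            funext p
            simp only [Nw, cast_desc_succ, Pi.mul_apply, Pi.add_apply, Pi.smul_apply, smul_eq_mul]
            ring⟩) ih
        convert this using 1
        funext p
        simp
        ring
    | succ b ih =>
      have := WW_mul S (fun p => (p.1.2.1 : K)) (fun s => ⟨(s.1, s.2.1 + 1, s.2.2), (s.2.1 : K),
          by simp only [Pt.deg]; omega, by
            funext p
            simp only [Nw, cast_desc_succ, Pi.mul_apply, Pi.add_apply, Pi.smul_apply, smul_eq_mul]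
            ring⟩) ih
      convert this using 1
      · exact congrArg _ (by omega)
      funext p
      simp
      ring
  | succ c ih =>
    have := WW_mul S (fun p => (p.1.2.2 : K)) (fun s => ⟨(s.1, s.2.1, s.2.2 + 1), (s.2.2 : K),
          by simp only [Pt.deg]; omega, by
            funext p
            simp only [Nw, cast_desc_succ, Pi.mul_apply, Pi.add_apply, Pi.smul_apply, smul_eq_mul]
            ring⟩) ih
    convert this using 1
    · exact congrArg _ (by omega)
    funext p
    simp
    ring

theorem EE_le_WW (S : Finset Pt) (i : ℕ) : EE K S i ≤ WW K S i := by
  rintro _ ⟨f, hf, rfl⟩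
  rw [f.as_sum, map_sum]
  refine Submodule.sum_mem _ fun d hd => ?_
  have hdeg : d.degree = i := by
    have := hf (mem_support_iff.1 hd)
    rwa [show (Finsupp.weight (1 : Fin 4 → ℕ)) d = d.degree from by
      rw [Finsupp.degree_eq_weight_one]; rfl] at this
  have h4 : d 0 + d 1 + d 2 ≤ i := by
    rw [← hdeg, Finsupp.degree_eq_sum, Fin.sum_univ_four]
    omega
  have h5 : ev K S (monomial d (coeff d f)) = coeff d f •
      (fun p : {x // x ∈ S} =>
        (p.1.1 : K) ^ d 0 * (p.1.2.1 : K) ^ d 1 * (p.1.2.2 : K) ^ d 2) := by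
    funext p
    rw [ev_apply, aeval_monomial, Finsupp.prod_fintype _ _ (by simp), Fin.prod_univ_four]
    simp [pt]
  rw [h5]
  exact Submodule.smul_mem _ _ (WW_mono S h4 (mono_mem_WW S _ _ _))

theorem EE_eq_WW (S : Finset Pt) (i : ℕ) : EE K S i = WW K S i :=
  le_antisymm (EE_le_WW S i) (WW_le_EE S i)

def Low (S : Finset Pt) : Prop :=
  ∀ t ∈ S, ∀ a < t.1 + 1, ∀ b < t.2.1 + 1, ∀ c < t.2.2 + 1, (a, b, c) ∈ S

instance (S : Finset Pt) : Decidable (Low S) := by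
  unfold Low; infer_instance

theorem Nw_ne [CharZero K] (S : Finset Pt) (s : Pt) (p : {x // x ∈ S}) :
    Nw K S s p ≠ 0 ↔ s.1 ≤ p.1.1 ∧ s.2.1 ≤ p.1.2.1 ∧ s.2.2 ≤ p.1.2.2 := by
  simp only [Nw, mul_ne_zero_iff, Nat.cast_ne_zero, Ne, Nat.descFactorial_eq_zero_iff_lt, not_lt,
    and_assoc]

theorem Nw_zero [CharZero K] {S : Finset Pt} (hS : Low S) {s : Pt} (hs : s ∉ S) :
    Nw K S s = 0 := by
  funext p
  by_contra h
  obtain ⟨h1, h2, h3⟩ := (Nw_ne S s p).1 h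
  exact hs (hS p.1 p.2 s.1 (by omega) s.2.1 (by omega) s.2.2 (by omega))

theorem Nw_indep [CharZero K] (S : Finset Pt) :
    LinearIndependent K (fun s : {x // x ∈ S} => Nw K S s.1) := by
  rw [Fintype.linearIndependent_iff]
  intro g hg
  have key : ∀ n : ℕ, ∀ s : {x // x ∈ S}, s.1.deg = n → g s = 0 := by
    intro n
    induction n using Nat.strong_induction_on with
    | _ n ih =>
      intro s hs
      have h1 := congrFun hg s
      rw [Finset.sum_apply, Finset.sum_eq_single s] at h1
      · have h2 : Nw K S s.1 s ≠ 0 := (Nw_ne S s.1 s).2 ⟨le_rfl, le_rfl, le_rfl⟩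
        simpa [h2] using h1
      · intro t _ hts
        by_cases h2 : Nw K S t.1 s = 0
        · simp [h2]
        · obtain ⟨h3, h4, h5⟩ := (Nw_ne S t.1 s).1 h2
          have h6 : t.1.deg < n := by
            rcases lt_or_eq_of_le (show t.1.deg ≤ n by rw [← hs]; simp only [Pt.deg]; omega)
              with h | h
            · exact h
            · exfalso
              apply hts
              rw [← hs] at h
              simp only [Pt.deg] at h
              refine Subtype.ext (Prod.ext ?_ (Prod.ext ?_ ?_)) <;> omega
          simp [ih _ h6 t rfl]
      · simp
  exact fun s => key _ s rfl

theorem finrank_EE [CharZero K] {S : Finset Pt} (hS : Low S) (i : ℕ) :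
    Module.finrank K (EE K S i) = (S.filter fun s => s.deg ≤ i).card := by
  have h1 : EE K S i = Submodule.span K
      (Set.range fun s : {s : {x // x ∈ S} // s.1.deg ≤ i} => Nw K S s.1.1) := by
    rw [EE_eq_WW]
    apply le_antisymm
    · refine Submodule.span_le.2 ?_
      rintro _ ⟨s, hs, rfl⟩
      by_cases h : s ∈ S
      · exact Submodule.subset_span ⟨⟨⟨s, h⟩, hs⟩, rfl⟩
      · rw [Nw_zero hS h]
        exact Submodule.zero_mem _
    · refine Submodule.span_le.2 ?_
      rintro _ ⟨s, rfl⟩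
      exact Submodule.subset_span ⟨s.1.1, s.2, rfl⟩
  have h2 : LinearIndependent K
      (fun s : {s : {x // x ∈ S} // s.1.deg ≤ i} => Nw K S s.1.1) :=
    (Nw_indep S).comp (fun s : {s : {x // x ∈ S} // s.1.deg ≤ i} => s.1)
      Subtype.val_injective
  rw [h1, finrank_span_eq_card h2]
  rw [Fintype.card_subtype, ← Finset.card_map (Function.Embedding.subtype (· ∈ S))]
  congr 1
  ext s
  simp [and_comm]

theorem EE_top [CharZero K] {S : Finset Pt} (hS : Low S) {i : ℕ} (hi : ∀ s ∈ S, s.deg ≤ i) :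
    EE K S i = ⊤ := by
  apply Submodule.eq_top_of_finrank_eq
  rw [finrank_EE hS, Finset.filter_true_of_mem hi]
  simp

/-- The functional. -/
def phi (K : Type*) [Field K] (S : Finset Pt) : MvPolynomial (Fin 4) K →ₗ[K] K :=
  (∑ p : {x // x ∈ S}, LinearMap.proj p) ∘ₗ ev K S ∘ₗ homogeneousComponent 8

theorem phi_apply (S : Finset Pt) (f : MvPolynomial (Fin 4) K) :
    phi K S f = ∑ p, ev K S (homogeneousComponent 8 f) p := by
  simp [phi]

def II (K : Type*) [Field K] (S : Finset Pt) : Ideal (MvPolynomial (Fin 4) K) where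
  carrier := {f | ∀ g, phi K S (f * g) = 0}
  add_mem' := by
    intro a b ha hb g
    rw [add_mul, map_add, ha g, hb g, add_zero]
  zero_mem' := by intro g; simp
  smul_mem' := by
    intro c f hf g
    rw [smul_eq_mul, mul_comm c f, mul_assoc]
    exact hf _

theorem mem_II (S : Finset Pt) (f : MvPolynomial (Fin 4) K) :
    f ∈ II K S ↔ ∀ g, phi K S (f * g) = 0 := Iff.rfl

theorem phi_mul (S : Finset Pt) {f : MvPolynomial (Fin 4) K} {i : ℕ} (hi : i ≤ 8)
    (hf : f ∈ homogeneousSubmodule (Fin 4) K i) (g : MvPolynomial (Fin 4) K) :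
    phi K S (f * g) = ∑ p, ev K S f p * ev K S (homogeneousComponent (8 - i) g) p := by
  rw [phi_apply, hc_mul_left hf, if_pos hi, ev_mul]
  rfl

theorem phi_mul_gt (S : Finset Pt) {f : MvPolynomial (Fin 4) K} {i : ℕ} (hi : 8 < i)
    (hf : f ∈ homogeneousSubmodule (Fin 4) K i) (g : MvPolynomial (Fin 4) K) :
    phi K S (f * g) = 0 := by
  rw [phi_apply, hc_mul_left hf, if_neg (by omega)]
  simp

theorem mem_II_gt (S : Finset Pt) {f : MvPolynomial (Fin 4) K} {i : ℕ} (hi : 8 < i)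
    (hf : f ∈ homogeneousSubmodule (Fin 4) K i) : f ∈ II K S :=
  fun g => phi_mul_gt S hi hf g

theorem mem_II_iff (S : Finset Pt) {f : MvPolynomial (Fin 4) K} {i : ℕ} (hi : i ≤ 8)
    (hf : f ∈ homogeneousSubmodule (Fin 4) K i) :
    f ∈ II K S ↔ ∀ v ∈ EE K S (8 - i), ∑ p, ev K S f p * v p = 0 := by
  constructor
  · rintro h _ ⟨g, hg, rfl⟩
    have := h g
    rwa [phi_mul S hi hf, homogeneousComponent_eq_self hg] at this
  · intro h g
    rw [phi_mul S hi hf]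
    exact h _ ⟨_, homogeneousComponent_mem _ _, rfl⟩

theorem II_homog (S : Finset Pt) : IdealHomog (II K S) := by
  intro f hf d
  rcases Nat.lt_or_ge 8 d with hd | hd
  · exact mem_II_gt S hd (homogeneousComponent_mem _ _)
  · rw [mem_II_iff S hd (homogeneousComponent_mem _ _)]
    rintro _ ⟨g, hg, rfl⟩
    have h1 := hf g
    rw [mul_comm, phi_mul S (Nat.sub_le 8 d) hg, Nat.sub_sub_self hd] at h1
    rw [← h1]
    exact Finset.sum_congr rfl fun p _ => mul_comm _ _

theorem mem_II_of_components (S : Finset Pt) (f : MvPolynomial (Fin 4) K)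
    (h : ∀ d ≤ 8, homogeneousComponent d f ∈ II K S) : f ∈ II K S := by
  rw [← sum_homogeneousComponent f]
  refine Ideal.sum_mem _ fun d _ => ?_
  rcases Nat.lt_or_ge 8 d with hd | hd
  · exact mem_II_gt S hd (homogeneousComponent_mem _ _)
  · exact h d hd

theorem finrank_map_eq {V W W' : Type*} [AddCommGroup V] [Module K V] [AddCommGroup W]
    [Module K W] [AddCommGroup W'] [Module K W'] (P : Submodule K V) (f : V →ₗ[K] W)
    (g : V →ₗ[K] W') (h : ∀ v ∈ P, f v = 0 ↔ g v = 0) :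
    Module.finrank K (P.map f) = Module.finrank K (P.map g) := by
  have hk : LinearMap.ker (f.domRestrict P) = LinearMap.ker (g.domRestrict P) := by
    ext v
    simpa using h v.1 v.2
  rw [← LinearMap.range_domRestrict, ← LinearMap.range_domRestrict]
  exact LinearEquiv.finrank_eq ((f.domRestrict P).quotKerEquivRange.symm ≪≫ₗ
    Submodule.quotEquivOfEq _ _ hk ≪≫ₗ (g.domRestrict P).quotKerEquivRange)

theorem mk_zero_iff (S : Finset Pt) (f : MvPolynomial (Fin 4) K) :
    (Ideal.Quotient.mkₐ K (II K S)).toLinearMap f = 0 ↔ f ∈ II K S :=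
  Ideal.Quotient.eq_zero_iff_mem

theorem hilb_low [CharZero K] {S : Finset Pt} (hS : Low S) (hd : ∀ s ∈ S, s.deg ≤ 4)
    {i : ℕ} (hi : i ≤ 4) :
    hilb 4 K (II K S) i = (S.filter fun s => s.deg ≤ i).card := by
  rw [← finrank_EE (K := K) hS, hilb, EE]
  refine finrank_map_eq _ _ _ fun f hf => ?_
  rw [mk_zero_iff, mem_II_iff S (by omega) hf, EE_top hS (fun s hs => (hd s hs).trans (by omega))]
  constructor
  · intro h
    funext p
    have := h (Pi.single p 1) trivial
    simpa [Pi.single_apply] using this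
  · intro h v _
    simp [h]

/-- The dot product as a map to functionals on a subspace. -/
def dotE (S : Finset Pt) (E : Submodule K ({x // x ∈ S} → K)) :
    ({x // x ∈ S} → K) →ₗ[K] Module.Dual K E :=
  E.subtype.dualMap ∘ₗ (dotProductBilin K K)

theorem dotE_apply (S : Finset Pt) (E : Submodule K ({x // x ∈ S} → K)) (u v) :
    dotE S E u v = ∑ p, u p * v.1 p := rfl

theorem dotE_surj (S : Finset Pt) (E : Submodule K ({x // x ∈ S} → K)) :
    Function.Surjective (dotE S E) := by
  intro l
  obtain ⟨L, hL⟩ := LinearMap.exists_extend l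
  refine ⟨fun p => L (Pi.single p 1), ?_⟩
  ext v
  rw [dotE_apply, ← hL, LinearMap.comp_apply, Submodule.subtype_apply,
    LinearMap.pi_apply_eq_sum_univ L v.1]
  refine Finset.sum_congr rfl fun p _ => ?_
  rw [smul_eq_mul, mul_comm]
  congr 2
  funext q
  simp [Pi.single_apply, eq_comm]

theorem hilb_high [CharZero K] {S : Finset Pt} (hS : Low S) (hd : ∀ s ∈ S, s.deg ≤ 4)
    {i : ℕ} (hi : 4 ≤ i) (hi8 : i ≤ 8) :
    hilb 4 K (II K S) i = (S.filter fun s => s.deg ≤ 8 - i).card := by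
  have h1 : hilb 4 K (II K S) i = Module.finrank K
      ((homogeneousSubmodule (Fin 4) K i).map (dotE S (EE K S (8 - i)) ∘ₗ ev K S)) := by
    refine finrank_map_eq _ _ _ fun f hf => ?_
    rw [mk_zero_iff, mem_II_iff S hi8 hf]
    constructor
    · intro h
      ext v
      exact h v.1 v.2
    · intro h v hv
      exact LinearMap.congr_fun h ⟨v, hv⟩
  have h2 : (homogeneousSubmodule (Fin 4) K i).map (ev K S) = ⊤ :=
    EE_top hS (fun s hs => (hd s hs).trans hi)
  rw [h1, Submodule.map_comp, h2, Submodule.map_top, LinearMap.range_eq_top.2 (dotE_surj S _),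
    finrank_top, Subspace.dual_finrank_eq, finrank_EE hS]

theorem hilb_gt (S : Finset Pt) {i : ℕ} (hi : 8 < i) : hilb 4 K (II K S) i = 0 := by
  have : (homogeneousSubmodule (Fin 4) K i).map
      (Ideal.Quotient.mkₐ K (II K S)).toLinearMap = ⊥ := by
    rw [eq_bot_iff]
    rintro _ ⟨f, hf, rfl⟩
    exact (mk_zero_iff S f).2 (mem_II_gt S hi hf)
  rw [hilb, this, finrank_bot]

theorem II_finite (S : Finset Pt) :
    FiniteDimensional K (MvPolynomial (Fin 4) K ⧸ II K S) := by
  let Φ : MvPolynomial (Fin 4) K →ₗ[K] (Fin 9 → {x // x ∈ S} → K) :=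
    LinearMap.pi fun d => ev K S ∘ₗ homogeneousComponent d.1
  have hΦ : LinearMap.ker Φ ≤ LinearMap.ker (Ideal.Quotient.mkₐ K (II K S)).toLinearMap := by
    intro f hf
    rw [LinearMap.mem_ker, mk_zero_iff]
    refine mem_II_of_components S f fun d hd => ?_
    rw [mem_II_iff S hd (homogeneousComponent_mem _ _)]
    intro v _
    have : ev K S (homogeneousComponent d f) = 0 :=
      congrFun (LinearMap.mem_ker.1 hf) ⟨d, by omega⟩
    simp [this]
  have : FiniteDimensional K (MvPolynomial (Fin 4) K ⧸ LinearMap.ker Φ) :=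
    Module.Finite.equiv Φ.quotKerEquivRange.symm
  refine Module.Finite.of_surjective
    ((LinearMap.ker Φ).liftQ (Ideal.Quotient.mkₐ K (II K S)).toLinearMap hΦ) ?_
  intro y
  obtain ⟨f, rfl⟩ := Ideal.Quotient.mk_surjective y
  exact ⟨Submodule.Quotient.mk f, rfl⟩

theorem mem_socle (S : Finset Pt) (f : MvPolynomial (Fin 4) K) :
    Ideal.Quotient.mk (II K S) f ∈ socleSub 4 K (II K S) ↔ ∀ k, X k * f ∈ II K S := by
  simp only [socleSub, Submodule.mem_iInf, LinearMap.mem_ker, LinearMap.mulLeft_apply,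
    ← map_mul, Ideal.Quotient.eq_zero_iff_mem]

theorem II_socle [CharZero K] {S : Finset Pt} (hS : Low S) (hd : ∀ s ∈ S, s.deg ≤ 4)
    (h0 : S.Nonempty) :
    Module.finrank K (socleSub 4 K (II K S)) = 1 := by
  -- a form of degree 8 not killed by `phi`
  obtain ⟨s, hs⟩ := h0
  have h1 : (Pi.single ⟨s, hs⟩ 1 : {x // x ∈ S} → K) ∈ EE K S 8 := by
    rw [EE_top hS (fun s hs => (hd s hs).trans (by omega))]
    trivial
  obtain ⟨f, hf, hfe⟩ := h1
  have hphi : phi K S f = 1 := by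
    rw [phi_apply, homogeneousComponent_eq_self hf, hfe]
    simp
  have hfs : Ideal.Quotient.mk (II K S) f ∈ socleSub 4 K (II K S) := by
    rw [mem_socle]
    intro k
    refine mem_II_gt S (i := 1 + 8) (by omega) ?_
    exact IsHomogeneous.mul (isHomogeneous_X K k) hf
  refine finrank_eq_one (⟨_, hfs⟩ : socleSub 4 K (II K S)) ?_ ?_
  · intro h
    have h2 : Ideal.Quotient.mk (II K S) f = 0 := congrArg Subtype.val h
    rw [Ideal.Quotient.eq_zero_iff_mem] at h2
    have h3 := h2 1
    rw [mul_one, hphi] at h3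
    exact one_ne_zero h3
  · rintro ⟨y, hy⟩
    obtain ⟨g, rfl⟩ := Ideal.Quotient.mk_surjective y
    refine ⟨phi K S g, Subtype.ext ?_⟩
    change phi K S g • Ideal.Quotient.mk (II K S) f = Ideal.Quotient.mk (II K S) g
    have h4 : phi K S g • Ideal.Quotient.mk (II K S) f
        = Ideal.Quotient.mk (II K S) (phi K S g • f) := rfl
    rw [h4, Ideal.Quotient.eq]
    have hu : ∀ k, X k * (phi K S g • f - g) ∈ II K S := by
      rw [← mem_socle, map_sub]
      exact Submodule.sub_mem _ (Submodule.smul_mem _ (phi K S g) hfs) hy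
    have hu0 : phi K S (phi K S g • f - g) = 0 := by
      rw [map_sub, map_smul, hphi]
      simp
    generalize phi K S g • f - g = u at hu hu0
    intro q
    induction q using MvPolynomial.induction_on with
    | C a =>
      rw [mul_comm, ← smul_eq_C_mul, map_smul, hu0, smul_zero]
    | add p q hp hq => rw [mul_add, map_add, hp, hq, add_zero]
    | mul_X p k _ =>
      have := hu k p
      rwa [show u * (p * X k) = X k * u * p by ring]

theorem main_of_set [CharZero K] {S : Finset Pt} (h b : ℕ) (hS : Low S)
    (hd : ∀ s ∈ S, s.deg ≤ 4)
    (c0 : (S.filter fun s => s.deg ≤ 0).card = 1) (c1 : (S.filter fun s => s.deg ≤ 1).card = 4)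
    (c2 : (S.filter fun s => s.deg ≤ 2).card = 7) (c3 : (S.filter fun s => s.deg ≤ 3).card = h)
    (c4 : (S.filter fun s => s.deg ≤ 4).card = b) :
    ∃ I : Ideal (MvPolynomial (Fin 4) K), IsAG 4 K I 8 ∧
      hilb 4 K I 0 = 1 ∧ hilb 4 K I 1 = 4 ∧ hilb 4 K I 2 = 7 ∧
      hilb 4 K I 3 = h ∧ hilb 4 K I 4 = b ∧ hilb 4 K I 5 = h ∧
      hilb 4 K I 6 = 7 ∧ hilb 4 K I 7 = 4 ∧ hilb 4 K I 8 = 1 := by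
  have hne : S.Nonempty := by
    rw [Finset.nonempty_iff_ne_empty]
    rintro rfl
    simp at c0
  have e8 : hilb 4 K (II K S) 8 = 1 := (hilb_high hS hd (by omega) (by omega)).trans c0
  refine ⟨II K S, ⟨II_homog S, II_finite S, II_socle hS hd hne, by omega,
    fun i hi => hilb_gt S hi⟩, ?_, ?_, ?_, ?_, ?_, ?_, ?_, ?_, e8⟩
  · exact (hilb_low hS hd (by omega)).trans c0
  · exact (hilb_low hS hd (by omega)).trans c1
  · exact (hilb_low hS hd (by omega)).trans c2
  · exact (hilb_low hS hd (by omega)).trans c3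
  · exact (hilb_low hS hd (by omega)).trans c4
  · exact (hilb_high hS hd (by omega) (by omega)).trans c3
  · exact (hilb_high hS hd (by omega) (by omega)).trans c2
  · exact (hilb_high hS hd (by omega) (by omega)).trans c1

end Helper

/-- The order ideal with `h - 7` elements of degree 3 and `b - h` elements of degree 4. -/
def SS (h b : ℕ) : Finset Pt :=
  ([(0, 0, 0), (1, 0, 0), (0, 1, 0), (0, 0, 1), (2, 0, 0), (1, 1, 0), (0, 2, 0)] ++
    [(3, 0, 0), (2, 1, 0), (1, 2, 0), (0, 3, 0)].take (h - 7) ++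
    [(4, 0, 0), (3, 1, 0), (2, 2, 0), (1, 3, 0), (0, 4, 0)].take (b - h) : List Pt).toFinset

def SSok (h b : ℕ) : Prop :=
    Low (SS h b) ∧ (∀ s ∈ SS h b, s.deg ≤ 4) ∧
    ((SS h b).filter fun s => s.deg ≤ 0).card = 1 ∧
    ((SS h b).filter fun s => s.deg ≤ 1).card = 4 ∧
    ((SS h b).filter fun s => s.deg ≤ 2).card = 7 ∧
    ((SS h b).filter fun s => s.deg ≤ 3).card = h ∧
    ((SS h b).filter fun s => s.deg ≤ 4).card = b

instance (h b : ℕ) : Decidable (SSok h b) := by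
  unfold SSok; infer_instance

theorem SS_ok : ∀ h < 12, 7 ≤ h → ∀ b < 17, h ≤ b → b ≤ bmax h → SSok h b := by
  decide +kernel

/-- For every pair `(h,b)` with `7 ≤ h ≤ 11` and
`h ≤ b ≤ b_max(h)` there is a graded Artinian Gorenstein quotient of
`K[w,x,y,z]` of socle degree `8` with Hilbert function
`(1,4,7,h,b,h,7,4,1)`. -/
theorem statement_15 {K : Type*} [Field K] [IsAlgClosed K] [CharZero K]
    (h b : ℕ) (hh7 : 7 ≤ h) (hh11 : h ≤ 11) (hhb : h ≤ b) (hbmax : b ≤ bmax h) :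
    ∃ I : Ideal (MvPolynomial (Fin 4) K), IsAG 4 K I 8 ∧
      hilb 4 K I 0 = 1 ∧ hilb 4 K I 1 = 4 ∧ hilb 4 K I 2 = 7 ∧
      hilb 4 K I 3 = h ∧ hilb 4 K I 4 = b ∧ hilb 4 K I 5 = h ∧
      hilb 4 K I 6 = 7 ∧ hilb 4 K I 7 = 4 ∧ hilb 4 K I 8 = 1 := by
  have hb : b < 17 := by
    unfold bmax at hbmax
    split_ifs at hbmax <;> omega
  obtain ⟨h1, h2, c0, c1, c2, c3, c4⟩ := SS_ok h (by omega) hh7 b hb hhb hbmax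
  exact main_of_set h b h1 h2 c0 c1 c2 c3 c4

end
end
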